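/- arXiv:math/0503053 — 2 statements merged into one kernel-verified Lean document; each statement's English description precedes it below -/
import Mathlib

section
/- (Gerstenhaber commutativity, Theorem 1.2.) Let a be a unital associative algebra over a field k of characteristic zero, let A^e = a ⊗_k a^op, and regard a as a left A^e-module via (x ⊗ y^op)·z = x z y. Then the Yoneda product on the Ext-algebra of a in the abelian category of A^e-modules is graded commutative: for all m, n ≥ 0 and all ξ ∈ Ext^m_{A^e}(a, a), η ∈ Ext^n_{A^e}(a, a), one has η ∘ ξ = (−1)^{mn} ξ ∘ η in Ext^{m+n}_{A^e}(a, a). -/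
open scoped TensorProduct
open CategoryTheory

noncomputable section

attribute [local instance] HasDerivedCategory.standard

universe u
variable (k : Type u) [Field k] [CharZero k]
variable (A : Type u) [Ring A] [Algebra k A]

/-- Right multiplication makes `Aᵐᵒᵖ` act on `A`; as an algebra map `Aᵐᵒᵖ → End_k(A)`. -/
def rmulHom : Aᵐᵒᵖ →ₐ[k] Module.End k A where
  toFun y := LinearMap.mulRight k y.unop
  map_one' := by ext a; simp
  map_mul' x y := by ext a; simp [mul_assoc]
  map_zero' := by ext a; simp
  map_add' x y := by ext a; simp [mul_add]
  commutes' c := by ext a; simp [Algebra.algebraMap_eq_smul_one, Algebra.commutes]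

/-- The action of the enveloping algebra `A^e = A ⊗ₖ Aᵐᵒᵖ` on `A`, `(x ⊗ yᵒᵖ) • z = x z y`,
as an algebra map `A^e → End_k(A)`. -/
def envActHom : (A ⊗[k] Aᵐᵒᵖ) →ₐ[k] Module.End k A :=
  Algebra.TensorProduct.lift (Algebra.lmul k A) (rmulHom k A)
    (fun x y => by ext a; simp [rmulHom, mul_assoc])

/-- `A` as a left module over its enveloping algebra `A^e = A ⊗ₖ Aᵐᵒᵖ`. -/
instance : Module (A ⊗[k] Aᵐᵒᵖ) A := Module.compHom A (envActHom k A).toRingHom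

instance : HasExt.{u+1} (ModuleCat.{u} (A ⊗[k] Aᵐᵒᵖ)) := hasExt_of_hasDerivedCategory _

section AbstractExt

open Limits Abelian

universe w v' u'

set_option linter.unusedSectionVars false

variable {C : Type u'} [Category.{v'} C] [Abelian C] [HasExt.{w} C]

lemma three_by_three {S₁ S₂ S₃ : ShortComplex C} (h₁ : S₁.ShortExact) (h₂ : S₂.ShortExact)
    (h₃ : S₃.ShortExact) (φ : S₁ ⟶ S₂) (ψ : S₂ ⟶ S₃)
    (z₁ : φ.τ₁ ≫ ψ.τ₁ = 0) (z₂ : φ.τ₂ ≫ ψ.τ₂ = 0) (z₃ : φ.τ₃ ≫ ψ.τ₃ = 0)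
    (t₁ : (ShortComplex.mk _ _ z₁).ShortExact) (t₂ : (ShortComplex.mk _ _ z₂).ShortExact)
    (t₃ : (ShortComplex.mk _ _ z₃).ShortExact) :
    t₃.extClass.comp h₁.extClass (rfl : 1 + 1 = 2) =
      - h₃.extClass.comp t₁.extClass (rfl : 1 + 1 = 2) := by
  have := h₁.mono_f; have := h₁.epi_g
  have := h₂.mono_f; have := h₂.epi_g
  have := h₃.mono_f; have := h₃.epi_g
  have := t₁.mono_f; have := t₁.epi_g
  have := t₂.mono_f; have := t₂.epi_g
  have := t₃.mono_f; have := t₃.epi_g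
  dsimp at *
  let d : S₂.X₂ ⟶ S₃.X₃ := S₂.g ≫ ψ.τ₃
  have hd : d = ψ.τ₂ ≫ S₃.g := ψ.comm₂₃.symm
  have : Epi d := epi_comp _ _
  let ι := kernel.ι d
  have hι : ι ≫ d = 0 := kernel.condition d
  let θ : ShortComplex C := ShortComplex.mk ι d hι
  have hθ : θ.ShortExact :=
    { exact := ShortComplex.exact_of_f_is_kernel _ (kernelIsKernel d)
      mono_f := by dsimp [θ, ι]; infer_instance
      epi_g := by dsimp [θ]; infer_instance }
  let q₁ : kernel d ⟶ S₁.X₃ := t₃.exact.lift (ι ≫ S₂.g) (by simpa [d] using hι)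
  have hq₁ : q₁ ≫ φ.τ₃ = ι ≫ S₂.g := t₃.exact.lift_f _ _
  let q₂ : kernel d ⟶ S₃.X₁ := h₃.exact.lift (ι ≫ ψ.τ₂) (by simpa [hd] using hι)
  have hq₂ : q₂ ≫ S₃.f = ι ≫ ψ.τ₂ := h₃.exact.lift_f _ _
  let j : S₁.X₁ ⟶ kernel d := kernel.lift d (S₁.f ≫ φ.τ₂) (by simp [hd, reassoc_of% z₂])
  have hj : j ≫ ι = S₁.f ≫ φ.τ₂ := kernel.lift_ι _ _ _
  let j₁ : S₁.X₂ ⟶ kernel d := kernel.lift d φ.τ₂ (by simp [hd, reassoc_of% z₂])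
  have hj₁ : j₁ ≫ ι = φ.τ₂ := kernel.lift_ι _ _ _
  let j₂ : S₂.X₁ ⟶ kernel d := kernel.lift d S₂.f (by simp [d])
  have hj₂ : j₂ ≫ ι = S₂.f := kernel.lift_ι _ _ _
  let q : kernel d ⟶ S₁.X₃ ⊞ S₃.X₁ := biprod.lift q₁ q₂
  have e11 : j₁ ≫ q₁ = S₁.g := by
    rw [← cancel_mono φ.τ₃, Category.assoc, hq₁, reassoc_of% hj₁, φ.comm₂₃]
  have e12 : j₁ ≫ q₂ = 0 := by
    rw [← cancel_mono S₃.f, Category.assoc, hq₂, reassoc_of% hj₁, z₂, zero_comp]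
  have e21 : j₂ ≫ q₁ = 0 := by
    rw [← cancel_mono φ.τ₃, Category.assoc, hq₁, reassoc_of% hj₂, S₂.zero, zero_comp]
  have e22 : j₂ ≫ q₂ = ψ.τ₁ := by
    rw [← cancel_mono S₃.f, Category.assoc, hq₂, reassoc_of% hj₂, ψ.comm₁₂]
  have f1 : j₁ ≫ q = S₁.g ≫ biprod.inl := by
    apply biprod.hom_ext <;> simp [q, e11, e12]
  have f2 : j₂ ≫ q = ψ.τ₁ ≫ biprod.inr := by
    apply biprod.hom_ext <;> simp [q, e21, e22]
  have g1 : S₁.f ≫ j₁ = j := by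
    rw [← cancel_mono ι, Category.assoc, hj₁, hj]
  have g2 : φ.τ₁ ≫ j₂ = j := by
    rw [← cancel_mono ι, Category.assoc, hj₂, hj, φ.comm₁₂]
  have hjq : j ≫ q = 0 := by
    rw [← g1, Category.assoc, f1, ← Category.assoc, S₁.zero, zero_comp]
  have : Epi q := by
    rw [Preadditive.epi_iff_cancel_zero]
    intro Z h hh
    apply biprod.hom_ext'
    · rw [← cancel_epi S₁.g, ← Category.assoc, ← f1, Category.assoc, hh]; simp
    · rw [← cancel_epi ψ.τ₁, ← Category.assoc, ← f2, Category.assoc, hh]; simp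
  have : Mono j := by
    have : Mono (j ≫ ι) := by rw [hj]; exact mono_comp _ _
    exact mono_of_mono j ι
  let ω : ShortComplex C := ShortComplex.mk j q hjq
  have hω : ω.ShortExact := 
    { exact := by
        apply ShortComplex.exact_of_f_is_kernel
        refine KernelFork.IsLimit.ofι' _ _ (fun {T} t ht => ?_)
        dsimp [ω] at t ht ⊢
        have ht1 : t ≫ q₁ = 0 := by
          have := ht =≫ biprod.fst
          simpa [q] using this
        have ht2 : t ≫ q₂ = 0 := by
          have := ht =≫ biprod.snd
          simpa [q] using this
        have a1 : (t ≫ ι) ≫ S₂.g = 0 := by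
          rw [Category.assoc, ← hq₁, reassoc_of% ht1, zero_comp]
        let s := h₂.exact.lift (t ≫ ι) a1
        have hs : s ≫ S₂.f = t ≫ ι := h₂.exact.lift_f _ _
        have a2 : s ≫ ψ.τ₁ = 0 := by
          rw [← cancel_mono S₃.f, Category.assoc, ψ.comm₁₂, reassoc_of% hs, ← hq₂,
            reassoc_of% ht2, zero_comp]
        refine ⟨t₁.exact.lift s a2, ?_⟩
        have a3 : t₁.exact.lift s a2 ≫ φ.τ₁ = s := t₁.exact.lift_f _ _
        rw [← cancel_mono ι, Category.assoc, hj, ← φ.comm₁₂, reassoc_of% a3, hs]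
      mono_f := by dsimp [ω]; infer_instance
      epi_g := by dsimp [ω]; infer_instance }
  have n1 := ShortComplex.ShortExact.extClass_naturality hθ t₃
    { τ₁ := q₁, τ₂ := S₂.g, τ₃ := 𝟙 _, comm₁₂ := hq₁, comm₂₃ := by simp [θ, d] }
  have n2 := ShortComplex.ShortExact.extClass_naturality hθ h₃
    { τ₁ := q₂, τ₂ := ψ.τ₂, τ₃ := 𝟙 _, comm₁₂ := hq₂, comm₂₃ := by simp [θ, hd] }
  have n3 := ShortComplex.ShortExact.extClass_naturality h₁ hω
    { τ₁ := 𝟙 _, τ₂ := j₁, τ₃ := biprod.inl, comm₁₂ := by simp [ω, g1], comm₂₃ := f1 }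
  have n4 := ShortComplex.ShortExact.extClass_naturality t₁ hω
    { τ₁ := 𝟙 _, τ₂ := j₂, τ₃ := biprod.inr, comm₁₂ := by simp [ω, g2], comm₂₃ := f2 }
  have key : hθ.extClass.comp ((Ext.mk₀ q).comp hω.extClass (zero_add 1)) (rfl : 1 + 1 = 2) = 0 := by
    have : (Ext.mk₀ q).comp hω.extClass (zero_add 1) = 0 := hω.comp_extClass
    rw [this, Ext.comp_zero]
  have hqq : Ext.mk₀ q = (Ext.mk₀ q₁).comp (Ext.mk₀ biprod.inl) (zero_add 0) +
      (Ext.mk₀ q₂).comp (Ext.mk₀ biprod.inr) (zero_add 0) := by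
    rw [Ext.mk₀_comp_mk₀, Ext.mk₀_comp_mk₀, ← Ext.mk₀_add]
    congr 1
    apply biprod.hom_ext <;> simp [q]
  dsimp at n1 n2 n3 n4
  rw [Ext.mk₀_id_comp] at n1 n2
  rw [Ext.comp_mk₀_id] at n3 n4
  rw [hqq, Ext.add_comp, Ext.comp_add, Ext.comp_assoc_of_second_deg_zero,
    Ext.comp_assoc_of_second_deg_zero] at key
  dsimp [ω] at n3 n4
  erw [← n3, ← n4] at key
  rw [← Ext.comp_assoc_of_second_deg_zero,← Ext.comp_assoc_of_second_deg_zero] at key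
  erw [n1, n2] at key
  exact eq_neg_of_add_eq_zero_left key

variable [EnoughProjectives C]

/-- Decomposition of a positive-degree class. -/
lemma ext_decomp {X Y : C} {n : ℕ} (η : Ext X Y (n + 1)) :
    ∃ (S : ShortComplex C) (hS : S.ShortExact) (hX : S.X₃ = X) (η' : Ext S.X₁ Y n),
      η = hX ▸ hS.extClass.comp η' (add_comm 1 n) := by
  let S := ShortComplex.mk _ _ (kernel.condition (Projective.π X))
  have hS : S.ShortExact :=
    { exact := ShortComplex.exact_of_f_is_kernel _ (kernelIsKernel S.g)
      mono_f := by dsimp [S]; infer_instance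
      epi_g := by dsimp [S]; infer_instance }
  obtain ⟨η', h⟩ := Ext.contravariant_sequence_exact₃ hS Y η (Ext.eq_zero_of_projective _)
    (add_comm 1 n)
  exact ⟨S, hS, rfl, η', h.symm⟩

lemma ext_induction {Y : C} (p : ∀ (n : ℕ) (X : C), Ext X Y n → Prop)
    (h0 : ∀ (X : C) (f : X ⟶ Y), p 0 X (Ext.mk₀ f))
    (h1 : ∀ (n : ℕ) (S : ShortComplex C) (hS : S.ShortExact) (η' : Ext S.X₁ Y n),
      p n _ η' → p (n + 1) S.X₃ (hS.extClass.comp η' (add_comm 1 n)))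
    {n : ℕ} {X : C} (η : Ext X Y n) : p n X η := by
  induction n generalizing X with
  | zero =>
    obtain ⟨f, rfl⟩ := (Ext.mk₀_bijective X Y).2 η
    exact h0 _ _
  | succ n ih =>
    obtain ⟨S, hS, rfl, η', rfl⟩ := ext_decomp η
    exact h1 _ _ _ _ (ih _)

section Functors

variable (F G H : C ⥤ C) [F.Additive] [G.Additive] [H.Additive]
  [PreservesFiniteLimits F] [PreservesFiniteColimits F]
  [PreservesFiniteLimits G] [PreservesFiniteColimits G]
  [PreservesFiniteLimits H] [PreservesFiniteColimits H]

variable {F G H}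

lemma map_natural_aux (τ : F ⟶ G) {S : ShortComplex C} (hS : S.ShortExact) :
    (hS.extClass.mapExactFunctor F).comp (Ext.mk₀ (τ.app S.X₁)) (add_zero 1) =
      (Ext.mk₀ (τ.app S.X₃)).comp (hS.extClass.mapExactFunctor G) (zero_add 1) := by
  rw [Ext.mapExactFunctor_extClass, Ext.mapExactFunctor_extClass]
  exact ShortComplex.ShortExact.extClass_naturality (hS.map_of_exact F) (hS.map_of_exact G)
      (S.mapNatTrans τ)

lemma map_natural (τ : F ⟶ G) {X Y : C} {n : ℕ} (η : Ext X Y n) :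
    (η.mapExactFunctor F).comp (Ext.mk₀ (τ.app Y)) (add_zero n) =
      (Ext.mk₀ (τ.app X)).comp (η.mapExactFunctor G) (zero_add n) := by
  refine ext_induction (Y := Y) (fun n X η => (η.mapExactFunctor F).comp (Ext.mk₀ (τ.app Y))
    (add_zero n) = (Ext.mk₀ (τ.app X)).comp (η.mapExactFunctor G) (zero_add n)) ?_ ?_ η
  · intro X f
    simp [Ext.mapExactFunctor_mk₀]
  · intro n S hS η' ih
    rw [Ext.mapExactFunctor_comp, Ext.mapExactFunctor_comp, Ext.comp_assoc_of_third_deg_zero, ih,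
      ← Ext.comp_assoc_of_second_deg_zero, map_natural_aux]
    rw [Ext.comp_assoc]
    lia

lemma map_id_functor {X Y : C} {n : ℕ} (η : Ext X Y n) : η.mapExactFunctor (𝟭 C) = η := by
  refine ext_induction (Y := Y) (fun n X η => η.mapExactFunctor (𝟭 C) = η) ?_ ?_ η
  · intro X f
    simp [Ext.mapExactFunctor_mk₀]
  · intro n S hS η' ih
    rw [Ext.mapExactFunctor_comp, ih, Ext.mapExactFunctor_extClass]
    rfl

lemma map_comp_functor {X Y : C} {n : ℕ} (η : Ext X Y n) :
    η.mapExactFunctor (F ⋙ G) = (η.mapExactFunctor F).mapExactFunctor G := by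
  refine ext_induction (Y := Y) (fun n X η => η.mapExactFunctor (F ⋙ G) =
    (η.mapExactFunctor F).mapExactFunctor G) ?_ ?_ η
  · intro X f
    simp [Ext.mapExactFunctor_mk₀]
  · intro n S hS η' ih
    have aux : hS.extClass.mapExactFunctor (F ⋙ G) =
        (hS.extClass.mapExactFunctor F).mapExactFunctor G := by
      rw [Ext.mapExactFunctor_extClass, Ext.mapExactFunctor_extClass]
      exact (Ext.mapExactFunctor_extClass G (hS.map_of_exact F)).symm
    rw [Ext.mapExactFunctor_comp, ih, Ext.mapExactFunctor_comp,
      Ext.mapExactFunctor_comp, aux]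

/-- The connecting class of a short exact sequence of functors. -/
def conn (α : F ⟶ G) (β : G ⟶ H) (z : ∀ X, α.app X ≫ β.app X = 0)
    (hz : ∀ X, (ShortComplex.mk _ _ (z X)).ShortExact) (X : C) : Ext (H.obj X) (F.obj X) 1 :=
  (hz X).extClass

lemma map_connecting_aux (α : F ⟶ G) (β : G ⟶ H) (z : ∀ X, α.app X ≫ β.app X = 0)
    (hz : ∀ X, (ShortComplex.mk _ _ (z X)).ShortExact) {S : ShortComplex C} (hS : S.ShortExact) :
    (conn α β z hz S.X₃).comp (hS.extClass.mapExactFunctor F) (rfl : 1 + 1 = 2) =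
      - (hS.extClass.mapExactFunctor H).comp (conn α β z hz S.X₁) (rfl : 1 + 1 = 2) := by
  rw [Ext.mapExactFunctor_extClass, Ext.mapExactFunctor_extClass]
  exact three_by_three (hS.map_of_exact F) (hS.map_of_exact G) (hS.map_of_exact H)
      (S.mapNatTrans α) (S.mapNatTrans β) (z _) (z _) (z _) (hz _) (hz _) (hz _)

lemma ext_comp_zsmul {X Y Z : C} {a b c : ℕ} (α : Ext X Y a) (β : Ext Y Z b) (h : a + b = c)
    (r : ℤ) : α.comp (r • β) h = r • α.comp β h :=
  map_zsmul (α.precomp Z h) r β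

lemma ext_zsmul_comp {X Y Z : C} {a b c : ℕ} (α : Ext X Y a) (β : Ext Y Z b) (h : a + b = c)
    (r : ℤ) : (r • α).comp β h = r • α.comp β h :=
  map_zsmul (β.postcomp X h) r α

lemma map_connecting (α : F ⟶ G) (β : G ⟶ H) (z : ∀ X, α.app X ≫ β.app X = 0)
    (hz : ∀ X, (ShortComplex.mk _ _ (z X)).ShortExact) {X Y : C} {n : ℕ} (η : Ext X Y n) :
    (conn α β z hz X).comp (η.mapExactFunctor F) (add_comm 1 n) =
      ((-1 : ℤ) ^ n) • (η.mapExactFunctor H).comp (conn α β z hz Y) rfl := by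
  refine ext_induction (Y := Y) (fun n X η =>
    (conn α β z hz X).comp (η.mapExactFunctor F) (add_comm 1 n) =
      ((-1 : ℤ) ^ n) • (η.mapExactFunctor H).comp (conn α β z hz Y) rfl) ?_ ?_ η
  · intro X f
    have := ShortComplex.ShortExact.extClass_naturality (hz X) (hz Y)
      { τ₁ := F.map f, τ₂ := G.map f, τ₃ := H.map f }
    simp only [Ext.mapExactFunctor_mk₀, pow_zero, one_smul]
    exact this
  · intro n S hS η' ih
    rw [Ext.mapExactFunctor_comp, Ext.mapExactFunctor_comp,
      ← Ext.comp_assoc (a₁₂ := 2) _ _ _ rfl (by lia) (by lia), map_connecting_aux,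
      Ext.neg_comp, Ext.comp_assoc (a₂₃ := n + 1) _ _ _ _ (by lia) (by lia), ih,
      Ext.comp_assoc (a₂₃ := n + 1) _ _ _ _ (by lia) (by lia), ext_comp_zsmul, pow_succ]
    simp

end Functors

/-- graded commutation of classes of degree `m` in `Ext(A, F A)`. -/
def Good (A : C) (F : C ⥤ C) [F.Additive] [PreservesFiniteLimits F] [PreservesFiniteColimits F]
    (m : ℕ) : Prop :=
  ∀ (Ξ : Ext A (F.obj A) m) (n : ℕ) (η : Ext A A n) (p : ℕ) (h : m + n = p),
    η.comp Ξ (by lia) = ((-1 : ℤ) ^ (m * n)) • Ξ.comp (η.mapExactFunctor F) h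

lemma good_succ (A : C) (F G H : C ⥤ C) [F.Additive] [G.Additive] [H.Additive]
    [PreservesFiniteLimits F] [PreservesFiniteColimits F]
    [PreservesFiniteLimits G] [PreservesFiniteColimits G]
    [PreservesFiniteLimits H] [PreservesFiniteColimits H]
    (α : F ⟶ G) (β : G ⟶ H) (z : ∀ X, α.app X ≫ β.app X = 0)
    (hz : ∀ X, (ShortComplex.mk _ _ (z X)).ShortExact) (m : ℕ)
    (hG : ∀ Ξ : Ext A (G.obj A) (m + 1), Ξ = 0) (hH : Good A H m) : Good A F (m + 1) := by
  intro Ξ n η p h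
  obtain ⟨Ξ', hΞ⟩ : ∃ Ξ' : Ext A (H.obj A) m, Ξ'.comp (conn α β z hz A) rfl = Ξ :=
    Ext.covariant_sequence_exact₁ A (hz A) Ξ (hG _) rfl
  subst hΞ
  rw [← Ext.comp_assoc (a₁₂ := m + n) _ _ _ (by lia) (by lia) (by lia), hH Ξ' n η _ rfl,
    ext_zsmul_comp, Ext.comp_assoc (a₂₃ := n + 1) _ _ _ _ (by lia) (by lia),
    Ext.comp_assoc (a₂₃ := n + 1) _ _ _ _ (by lia) (by lia),
    map_connecting α β z hz η, ext_comp_zsmul, smul_smul]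
  congr 1
  rw [← pow_add, add_mul, one_mul, add_assoc, pow_add, pow_add, ← mul_pow]
  simp

lemma good_zero (A : C) (F : C ⥤ C) [F.Additive]
    [PreservesFiniteLimits F] [PreservesFiniteColimits F]
    (h : ∀ g : A ⟶ F.obj A, ∃ τ : 𝟭 C ⟶ F, τ.app A = g) : Good A F 0 := by
  intro Ξ n η p hp
  obtain rfl : n = p := by lia
  obtain ⟨f, rfl⟩ := (Ext.mk₀_bijective _ _).2 Ξ
  obtain ⟨τ, rfl⟩ := h f
  have := map_natural τ η
  rw [map_id_functor] at this
  simp only [zero_mul, pow_zero, one_smul]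
  exact this

/-- vanishing criterion -/
lemma vanish (A Y : C) (F G : C ⥤ C) [F.Additive] [G.Additive]
    [PreservesFiniteLimits F] [PreservesFiniteColimits F]
    [PreservesFiniteLimits G] [PreservesFiniteColimits G] [Projective (F.obj A)]
    (τ : 𝟭 C ⟶ F ⋙ G) (ε : F.obj (G.obj Y) ⟶ Y) (hε : τ.app (G.obj Y) ≫ G.map ε = 𝟙 _)
    (m : ℕ) (Ξ : Ext A (G.obj Y) (m + 1)) : Ξ = 0 := by
  have h := map_natural τ Ξ
  rw [map_id_functor, map_comp_functor, Ext.eq_zero_of_projective (Ξ.mapExactFunctor F)] at h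
  have h' := congrArg (fun x => x.comp (Ext.mk₀ (G.map ε)) (add_zero _)) h
  dsimp at h'
  simpa [hε] using h'

/-- conclusion -/
lemma graded_comm_of_good (A : C) (F : C ⥤ C) [F.Additive]
    [PreservesFiniteLimits F] [PreservesFiniteColimits F] (τ : 𝟭 C ⟶ F) [IsIso (τ.app A)]
    (m : ℕ) (hF : Good A F m) (n : ℕ) (ξ : Ext A A m) (η : Ext A A n) :
    η.comp ξ (Nat.add_comm n m) = ((-1 : ℤ) ^ (m * n)) • ξ.comp η rfl := by
  have h := hF (ξ.comp (Ext.mk₀ (τ.app A)) (add_zero m)) n η _ rfl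
  have hn := map_natural τ η
  rw [map_id_functor] at hn
  rw [Ext.comp_assoc_of_second_deg_zero, ← hn, ← Ext.comp_assoc_of_third_deg_zero,
    ← Ext.comp_assoc_of_third_deg_zero, ← ext_zsmul_comp] at h
  have h' := congrArg (fun x => x.comp (Ext.mk₀ (inv (τ.app A))) (add_zero _)) h
  dsimp at h'
  simpa using h'

end AbstractExt


section Concrete

open scoped ModuleCat
open Limits

set_option linter.unusedSectionVars false

/-- Modules over the enveloping algebra. -/
abbrev BM := ModuleCat.{u} (A ⊗[k] Aᵐᵒᵖ)

variable {k A}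

/-- left action -/
def lHom (X : BM k A) : A →ₐ[k] Module.End k X :=
  (Algebra.lsmul k k X : (A ⊗[k] Aᵐᵒᵖ) →ₐ[k] Module.End k X).comp
    Algebra.TensorProduct.includeLeft

/-- right action -/
def rHom (X : BM k A) : Aᵐᵒᵖ →ₐ[k] Module.End k X :=
  (Algebra.lsmul k k X : (A ⊗[k] Aᵐᵒᵖ) →ₐ[k] Module.End k X).comp
    Algebra.TensorProduct.includeRight

lemma lHom_apply (X : BM k A) (a : A) (x : X) :
    lHom X a x = (a ⊗ₜ[k] (1 : Aᵐᵒᵖ)) • x := rfl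

lemma rHom_apply (X : BM k A) (b : Aᵐᵒᵖ) (x : X) :
    rHom X b x = ((1 : A) ⊗ₜ[k] b) • x := rfl

lemma lr_apply (X : BM k A) (a : A) (b : Aᵐᵒᵖ) (x : X) :
    (a ⊗ₜ[k] b) • x = lHom X a (rHom X b x) := by
  rw [lHom_apply, rHom_apply, smul_smul]; simp

lemma lr_comm (X : BM k A) (a : A) (b : Aᵐᵒᵖ) (x : X) :
    rHom X b (lHom X a x) = lHom X a (rHom X b x) := by
  simp only [lHom_apply, rHom_apply, smul_smul]; simp

/-- the `k`-linear map underlying a morphism -/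
def kl {X Y : BM k A} (f : X ⟶ Y) : X →ₗ[k] Y := f.hom.restrictScalars k

@[simp] lemma kl_apply {X Y : BM k A} (f : X ⟶ Y) (x : X) : kl f x = f x := rfl

lemma map_l {X Y : BM k A} (f : X ⟶ Y) (a : A) (x : X) : f (lHom X a x) = lHom Y a (f x) :=
  f.hom.map_smul _ x

lemma map_r {X Y : BM k A} (f : X ⟶ Y) (b : Aᵐᵒᵖ) (x : X) : f (rHom X b x) = rHom Y b (f x) :=
  f.hom.map_smul _ x

/-- build a morphism -/
def mkHom {X Y : BM k A} (f : X →ₗ[k] Y) (hl : ∀ a x, f (lHom X a x) = lHom Y a (f x))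
    (hr : ∀ b x, f (rHom X b x) = rHom Y b (f x)) : X ⟶ Y :=
  ModuleCat.ofHom
    { toFun := f
      map_add' := f.map_add
      map_smul' := fun e x => by
        dsimp
        induction e using TensorProduct.induction_on with
        | zero =>
          exact ((congrArg f (zero_smul (A ⊗[k] Aᵐᵒᵖ) x)).trans f.map_zero).trans
            (zero_smul (A ⊗[k] Aᵐᵒᵖ) (f x)).symm
        | tmul a b => rw [lr_apply, lr_apply, hl, hr]
        | add e e' h h' => rw [add_smul, add_smul, map_add, h, h'] }

@[simp] lemma mkHom_apply {X Y : BM k A} (f : X →ₗ[k] Y) (hl hr) (x : X) :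
    mkHom f hl hr x = f x := rfl

section mkObj

variable (W : Type u) [AddCommGroup W] [Module k W] (α : A →ₐ[k] Module.End k W)
  (β : Aᵐᵒᵖ →ₐ[k] Module.End k W) (h : ∀ a b, Commute (α a) (β b))

/-- build an object -/
def mkObj : BM k A :=
  letI : Module (A ⊗[k] Aᵐᵒᵖ) W :=
    Module.compHom W (Algebra.TensorProduct.lift α β h).toRingHom
  ModuleCat.of _ W

/-- underlying additive equiv -/
def mkEquiv₀ : mkObj W α β h ≃+ W := AddEquiv.refl W

lemma mkEquiv₀_smul (e : A ⊗[k] Aᵐᵒᵖ) (x : mkObj W α β h) :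
    mkEquiv₀ W α β h (e • x) = Algebra.TensorProduct.lift α β h e (mkEquiv₀ W α β h x) := rfl

/-- underlying linear equiv -/
def mkEquiv : mkObj W α β h ≃ₗ[k] W :=
  { mkEquiv₀ W α β h with
    map_smul' := fun c x => by
      change mkEquiv₀ W α β h (c • x) = c • mkEquiv₀ W α β h x
      rw [← algebraMap_smul (A ⊗[k] Aᵐᵒᵖ) c x, mkEquiv₀_smul, AlgHom.commutes]
      rfl }

lemma mkEquiv_l (a : A) (x : mkObj W α β h) :
    mkEquiv W α β h (lHom _ a x) = α a (mkEquiv W α β h x) := by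
  refine (mkEquiv₀_smul W α β h (a ⊗ₜ[k] (1 : Aᵐᵒᵖ)) x).trans ?_
  simp only [Algebra.TensorProduct.lift_tmul, map_one, mul_one]
  rfl

lemma mkEquiv_r (b : Aᵐᵒᵖ) (x : mkObj W α β h) :
    mkEquiv W α β h (rHom _ b x) = β b (mkEquiv W α β h x) := by
  refine (mkEquiv₀_smul W α β h ((1 : A) ⊗ₜ[k] b) x).trans ?_
  simp only [Algebra.TensorProduct.lift_tmul, map_one, one_mul]
  rfl

lemma mkEquiv_symm_l (a : A) (x : W) :
    lHom _ a ((mkEquiv W α β h).symm x) = (mkEquiv W α β h).symm (α a x) := by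
  apply (mkEquiv W α β h).injective; simp [mkEquiv_l]

lemma mkEquiv_symm_r (b : Aᵐᵒᵖ) (x : W) :
    rHom _ b ((mkEquiv W α β h).symm x) = (mkEquiv W α β h).symm (β b x) := by
  apply (mkEquiv W α β h).injective; simp [mkEquiv_r]

end mkObj

variable (k A) in
/-- the diagonal bimodule -/
def N0 : BM k A := ModuleCat.of (A ⊗[k] Aᵐᵒᵖ) A

variable (k A) in
/-- additive identification -/
def e₀ : N0 k A ≃+ A := AddEquiv.refl A

lemma e₀_smul (e : A ⊗[k] Aᵐᵒᵖ) (x : N0 k A) :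
    e₀ k A (e • x) = envActHom k A e (e₀ k A x) := rfl

variable (k A) in
/-- linear identification -/
def eN : N0 k A ≃ₗ[k] A :=
  { e₀ k A with
    map_smul' := fun c x => by
      change e₀ k A (c • x) = c • e₀ k A x
      rw [← algebraMap_smul (A ⊗[k] Aᵐᵒᵖ) c x, e₀_smul, AlgHom.commutes]
      rfl }

@[simp] lemma eN_l (a : A) (x : N0 k A) : eN k A (lHom _ a x) = a * eN k A x := by
  refine (e₀_smul (a ⊗ₜ[k] (1 : Aᵐᵒᵖ)) x).trans ?_
  have : envActHom k A (a ⊗ₜ[k] (1 : Aᵐᵒᵖ)) = Algebra.lmul k A a := by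
    refine (Algebra.TensorProduct.lift_tmul _ _ _ _ _).trans ?_
    rw [map_one, mul_one]
  rw [this]
  rfl

@[simp] lemma eN_r (b : Aᵐᵒᵖ) (x : N0 k A) : eN k A (rHom _ b x) = eN k A x * b.unop := by
  refine (e₀_smul ((1 : A) ⊗ₜ[k] b) x).trans ?_
  have : envActHom k A ((1 : A) ⊗ₜ[k] b) = rmulHom k A b := by
    refine (Algebra.TensorProduct.lift_tmul _ _ _ _ _).trans ?_
    rw [map_one, one_mul]
  rw [this]
  rfl

variable (k A) in
/-- the unit -/
def oneN : N0 k A := (eN k A).symm 1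

@[simp] lemma eN_one : eN k A (oneN k A) = 1 := by simp [oneN]

lemma l_one (x : N0 k A) : lHom _ (eN k A x) (oneN k A) = x := by
  apply (eN k A).injective; simp

lemma r_one (x : N0 k A) : rHom _ (MulOpposite.op (eN k A x)) (oneN k A) = x := by
  apply (eN k A).injective; simp

/-! ### internal hom -/

/-- left-linear maps -/
def HLin (M X : BM k A) : Submodule k (M →ₗ[k] X) where
  carrier := {h | ∀ a m, h (lHom M a m) = lHom X a (h m)}
  add_mem' := fun {f g} hf hg a m => by simp [hf a m, hg a m]
  zero_mem' := fun a m => by simp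
  smul_mem' := fun c f hf a m => by simp [hf a m]

/-- action of `A` -/
def Hα (M X : BM k A) : A →ₐ[k] Module.End k (HLin M X) where
  toFun a :=
    { toFun := fun h => ⟨h.1 ∘ₗ rHom M (MulOpposite.op a), fun a' m => by
        simp [lr_comm, h.2 a']⟩
      map_add' := fun _ _ => rfl
      map_smul' := fun _ _ => rfl }
  map_one' := by ext h m; simp
  map_mul' a b := by ext h m; simp
  map_zero' := by ext h m; simp
  map_add' a b := by ext h m; simp
  commutes' c := by
    ext h m
    have : MulOpposite.op (algebraMap k A c) = algebraMap k Aᵐᵒᵖ c := rfl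
    change h.1 (rHom M (MulOpposite.op (algebraMap k A c)) m) = c • h.1 m
    rw [this, AlgHom.commutes]
    exact h.1.map_smul c m

/-- action of the opposite -/
def Hβ (M X : BM k A) : Aᵐᵒᵖ →ₐ[k] Module.End k (HLin M X) where
  toFun b :=
    { toFun := fun h => ⟨rHom X b ∘ₗ h.1, fun a' m => by
        simp [h.2 a', lr_comm]⟩
      map_add' := fun _ _ => by ext; simp
      map_smul' := fun _ _ => by ext; simp }
  map_one' := by ext h m; simp
  map_mul' a b := by ext h m; simp
  map_zero' := by ext h m; simp
  map_add' a b := by ext h m; simp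
  commutes' c := by
    ext h m
    change rHom X (algebraMap k Aᵐᵒᵖ c) (h.1 m) = c • h.1 m
    rw [AlgHom.commutes]
    rfl

lemma Hcomm (M X : BM k A) (a : A) (b : Aᵐᵒᵖ) : Commute (Hα M X a) (Hβ M X b) := by
  ext h m; rfl

/-- internal hom -/
def Hobj (M X : BM k A) : BM k A := mkObj (HLin M X) (Hα M X) (Hβ M X) (Hcomm M X)

/-- equivalence -/
def Heq (M X : BM k A) : Hobj M X ≃ₗ[k] HLin M X :=
  mkEquiv (HLin M X) (Hα M X) (Hβ M X) (Hcomm M X)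

/-- evaluation -/
def ev {M X : BM k A} : Hobj M X →ₗ[k] (M →ₗ[k] X) := (HLin M X).subtype ∘ₗ (Heq M X).toLinearMap

/-- constructor -/
def hmk {M X : BM k A} (h : M →ₗ[k] X) (hh : ∀ a m, h (lHom M a m) = lHom X a (h m)) :
    Hobj M X := (Heq M X).symm ⟨h, hh⟩

@[simp] lemma ev_hmk {M X : BM k A} (h : M →ₗ[k] X) (hh) : ev (hmk h hh) = h := by
  simp [ev, hmk]

lemma ev_inj {M X : BM k A} {h h' : Hobj M X} (H : ∀ m, ev h m = ev h' m) : h = h' := by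
  apply (Heq M X).injective
  apply Subtype.ext
  exact LinearMap.ext H

lemma ev_left {M X : BM k A} (h : Hobj M X) (a : A) (m : M) :
    ev h (lHom M a m) = lHom X a (ev h m) := (Heq M X h).2 a m

@[simp] lemma ev_l {M X : BM k A} (h : Hobj M X) (a : A) (m : M) :
    ev (lHom _ a h) m = ev h (rHom M (MulOpposite.op a) m) := by
  have := mkEquiv_l (HLin M X) (Hα M X) (Hβ M X) (Hcomm M X) a h
  exact congrArg (fun x => x.1 m) this

@[simp] lemma ev_r {M X : BM k A} (h : Hobj M X) (b : Aᵐᵒᵖ) (m : M) :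
    ev (rHom _ b h) m = rHom X b (ev h m) := by
  have := mkEquiv_r (HLin M X) (Hα M X) (Hβ M X) (Hcomm M X) b h
  exact congrArg (fun x => x.1 m) this

/-- the linear map into `Hobj` -/
def hmkL {M X : BM k A} {V : Type*} [AddCommGroup V] [Module k V] (f : V →ₗ[k] (M →ₗ[k] X))
    (hh : ∀ v a m, f v (lHom M a m) = lHom X a (f v m)) : V →ₗ[k] Hobj M X :=
  (Heq M X).symm.toLinearMap ∘ₗ LinearMap.codRestrict (HLin M X) f hh

@[simp] lemma ev_hmkL {M X : BM k A} {V : Type*} [AddCommGroup V] [Module k V]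
    (f : V →ₗ[k] (M →ₗ[k] X)) (hh) (v : V) : ev (hmkL f hh v) = f v := by
  simp only [ev, hmkL, LinearMap.comp_apply, LinearEquiv.coe_coe, LinearEquiv.apply_symm_apply]
  rfl

lemma hcov_aux (M : BM k A) {X Y : BM k A} (f : X ⟶ Y) (v : Hobj M X) (a : A) (m : M) :
    ((LinearMap.llcomp k M X Y (kl f)) ∘ₗ ev) v (lHom M a m) =
      lHom Y a (((LinearMap.llcomp k M X Y (kl f)) ∘ₗ ev) v m) := by
  simp [ev_left, map_l]

/-- covariance -/
def hcov (M : BM k A) {X Y : BM k A} (f : X ⟶ Y) : Hobj M X ⟶ Hobj M Y :=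
  mkHom (hmkL ((LinearMap.llcomp k M X Y (kl f)) ∘ₗ ev) (hcov_aux M f))
    (fun a x => ev_inj fun m => by simp)
    (fun a x => ev_inj fun m => by simp [map_r])

@[simp] lemma ev_hcov (M : BM k A) {X Y : BM k A} (f : X ⟶ Y) (h : Hobj M X) (m : M) :
    ev (hcov M f h) m = f (ev h m) := by simp [hcov]

lemma hcon_aux {M M' : BM k A} (f : M ⟶ M') (X : BM k A) (v : Hobj M' X) (a : A) (m : M) :
    ((LinearMap.lcomp k X (kl f)) ∘ₗ ev) v (lHom M a m) =
      lHom X a (((LinearMap.lcomp k X (kl f)) ∘ₗ ev) v m) := by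
  simp [ev_left, map_l]

/-- contravariance -/
def hcon {M M' : BM k A} (f : M ⟶ M') (X : BM k A) : Hobj M' X ⟶ Hobj M X :=
  mkHom (hmkL ((LinearMap.lcomp k X (kl f)) ∘ₗ ev) (hcon_aux f X))
    (fun a x => ev_inj fun m => by simp [map_r])
    (fun a x => ev_inj fun m => by simp)

@[simp] lemma ev_hcon {M M' : BM k A} (f : M ⟶ M') {X : BM k A} (h : Hobj M' X) (m : M) :
    ev (hcon f X h) m = ev h (f m) := by simp [hcon]

lemma hom_ev {M X Y : BM k A} {f g : X ⟶ Hobj M Y} (h : ∀ x m, ev (f x) m = ev (g x) m) :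
    f = g := by
  ext x
  exact ev_inj (h x)

/-- the functor -/
def HF (M : BM k A) : BM k A ⥤ BM k A where
  obj X := Hobj M X
  map f := hcov M f
  map_id X := hom_ev fun h m => by simp
  map_comp f g := hom_ev fun h m => by simp

lemma hcov_add (M : BM k A) {X Y : BM k A} (f g : X ⟶ Y) :
    hcov M (f + g) = hcov M f + hcov M g := hom_ev fun h m => by simp

instance (M : BM k A) : (HF M).Additive where
  map_add {_ _ f g} := hcov_add M f g

lemma hcov_hcon {M M' : BM k A} (f : M ⟶ M') {X Y : BM k A} (g : X ⟶ Y) :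
    hcov M' g ≫ hcon f Y = hcon f X ≫ hcov M g := hom_ev fun h m => by simp

/-- contravariance, natural -/
def HFcon {M M' : BM k A} (f : M ⟶ M') : HF M' ⟶ HF M where
  app X := hcon f X
  naturality _ _ g := hcov_hcon f g

/-- left-projective -/
def LP (M : BM k A) : Prop :=
  ∀ (X Y : BM k A) (f : X ⟶ Y), Function.Surjective f → Function.Surjective (hcov M f)

lemma HF_map_short {M : BM k A} (hM : LP M) (S : ShortComplex (BM k A)) (hS : S.ShortExact) :
    (S.map (HF M)).ShortExact := by
  have hm := (ModuleCat.mono_iff_injective _).1 hS.mono_f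
  have he := (ModuleCat.epi_iff_surjective _).1 hS.epi_g
  have hx := (ShortComplex.ShortExact.moduleCat_exact_iff_function_exact _).1 hS.exact
  apply ModuleCat.shortComplex_shortExact
  · intro (h : Hobj M S.X₂)
    constructor
    · intro hh
      have h0 : ∀ m, S.g (ev h m) = 0 := fun m => by
        have h1 : hcov M S.g h = 0 := hh
        have h2 := congrArg (fun x => ev x m) h1
        simpa using h2
      have h1 : ∀ m, ∃ x, S.f x = ev h m := fun m => (hx _).1 (h0 m)
      let E := LinearEquiv.ofInjective (kl S.f) hm
      let q : M →ₗ[k] S.X₁ := E.symm.toLinearMap ∘ₗ LinearMap.codRestrict _ (ev h) h1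
      have hq : ∀ m, S.f (q m) = ev h m := fun m => by
        have : E (q m) = ⟨ev h m, h1 m⟩ := by simp [q]; rfl
        exact congrArg Subtype.val this
      refine ⟨hmk q fun a m => hm ?_, ?_⟩
      · rw [hq, map_l, hq, ev_left]
      · apply ev_inj
        intro m
        change ev (hcov M S.f _) m = _
        simp [hq]
    · rintro ⟨(y : Hobj M S.X₁), rfl⟩
      apply ev_inj
      intro m
      change ev (hcov M S.g (hcov M S.f y)) m = ev 0 m
      simp only [ev_hcov, map_zero, LinearMap.zero_apply]
      exact (hx _).2 ⟨_, rfl⟩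
  · intro (x : Hobj M S.X₁) (y : Hobj M S.X₁) hxy
    apply ev_inj
    intro m
    apply hm
    have h2 := congrArg (fun x => ev x m) (show hcov M S.f x = hcov M S.f y from hxy)
    simpa using h2
  · exact hM _ _ _ he

lemma HF_lim {M : BM k A} (hM : LP M) : PreservesFiniteLimits (HF M) :=
  (((Functor.exact_tfae (HF M)).out 0 3 rfl rfl).1 (HF_map_short hM)).1

lemma HF_colim {M : BM k A} (hM : LP M) : PreservesFiniteColimits (HF M) :=
  (((Functor.exact_tfae (HF M)).out 0 3 rfl rfl).1 (HF_map_short hM)).2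


/-- morphisms into the internal hom -/
def toH {X M Y : BM k A} (f : X →ₗ[k] M →ₗ[k] Y)
    (h1 : ∀ x a m, f x (lHom M a m) = lHom Y a (f x m))
    (h2 : ∀ x a m, f (lHom X a x) m = f x (rHom M (MulOpposite.op a) m))
    (h3 : ∀ x b m, f (rHom X b x) m = rHom Y b (f x m)) : X ⟶ Hobj M Y :=
  mkHom (hmkL f h1) (fun a x => ev_inj fun m => by rw [ev_l, ev_hmkL, ev_hmkL, h2])
    (fun b x => ev_inj fun m => by rw [ev_r, ev_hmkL, ev_hmkL, h3])

@[simp] lemma ev_toH {X M Y : BM k A} (f : X →ₗ[k] M →ₗ[k] Y) (h1 h2 h3) (x : X) (m : M) :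
    ev (toH f h1 h2 h3 x) m = f x m := by
  rw [toH, mkHom_apply, ev_hmkL]

/-- right multiplication, linear -/
def actR (X : BM k A) : A →ₗ[k] X →ₗ[k] X :=
  (rHom X).toLinearMap ∘ₗ (MulOpposite.opLinearEquiv k).toLinearMap

@[simp] lemma actR_apply (X : BM k A) (a : A) (x : X) :
    actR X a x = rHom X (MulOpposite.op a) x := rfl

/-- left multiplication, linear -/
def actL (X : BM k A) : A →ₗ[k] X →ₗ[k] X := (lHom X).toLinearMap

@[simp] lemma actL_apply (X : BM k A) (a : A) (x : X) : actL X a x = lHom X a x := rfl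

@[simp] lemma l_mul (X : BM k A) (a b : A) (x : X) :
    lHom X (a * b) x = lHom X a (lHom X b x) := by simp

@[simp] lemma r_op_mul (X : BM k A) (a b : A) (x : X) :
    rHom X (MulOpposite.op (a * b)) x = rHom X (MulOpposite.op b) (rHom X (MulOpposite.op a) x) := by
  simp

/-! ### tensor product -/

/-- left action on tensor product -/
def Lα (M Z : BM k A) : A →ₐ[k] Module.End k (M ⊗[k] Z) :=
  (Module.End.rTensorAlgHom k M Z).comp (lHom M)

/-- right action on tensor product -/
def Lβ (M Z : BM k A) : Aᵐᵒᵖ →ₐ[k] Module.End k (M ⊗[k] Z) :=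
  (Module.End.lTensorAlgHom k Z M).comp (rHom Z)

lemma Lcomm (M Z : BM k A) (a : A) (b : Aᵐᵒᵖ) : Commute (Lα M Z a) (Lβ M Z b) := by
  apply TensorProduct.ext'
  intro m z
  rfl

/-- tensor product over `k`, outer bimodule structure -/
def Lobj (M Z : BM k A) : BM k A := mkObj (M ⊗[k] Z) (Lα M Z) (Lβ M Z) (Lcomm M Z)

/-- underlying tensor product -/
def Leq (M Z : BM k A) : Lobj M Z ≃ₗ[k] M ⊗[k] Z :=
  mkEquiv (M ⊗[k] Z) (Lα M Z) (Lβ M Z) (Lcomm M Z)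

/-- pure tensors -/
def tm (M Z : BM k A) : M →ₗ[k] Z →ₗ[k] Lobj M Z :=
  (TensorProduct.mk k M Z).compr₂ (Leq M Z).symm.toLinearMap

lemma Leq_tm (M Z : BM k A) (m : M) (z : Z) : Leq M Z (tm M Z m z) = m ⊗ₜ[k] z := by
  simp [tm]

@[simp] lemma l_tm (M Z : BM k A) (a : A) (m : M) (z : Z) :
    lHom _ a (tm M Z m z) = tm M Z (lHom M a m) z :=
  mkEquiv_symm_l (M ⊗[k] Z) (Lα M Z) (Lβ M Z) (Lcomm M Z) a (m ⊗ₜ z)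

@[simp] lemma r_tm (M Z : BM k A) (b : Aᵐᵒᵖ) (m : M) (z : Z) :
    rHom _ b (tm M Z m z) = tm M Z m (rHom Z b z) :=
  mkEquiv_symm_r (M ⊗[k] Z) (Lα M Z) (Lβ M Z) (Lcomm M Z) b (m ⊗ₜ z)

lemma L_ext {M Z : BM k A} {V : Type*} [AddCommGroup V] [Module k V] {f g : Lobj M Z →ₗ[k] V}
    (h : ∀ m z, f (tm M Z m z) = g (tm M Z m z)) : f = g := by
  have : f ∘ₗ (Leq M Z).symm.toLinearMap = g ∘ₗ (Leq M Z).symm.toLinearMap :=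
    TensorProduct.ext' h
  ext x
  have := LinearMap.congr_fun this (Leq M Z x)
  simpa using this

lemma L_ext' {M Z : BM k A} {V : Type*} [AddCommGroup V] [Module k V] (f g : Lobj M Z →ₗ[k] V)
    (h : ∀ m z, f (tm M Z m z) = g (tm M Z m z)) (x : Lobj M Z) : f x = g x := by
  rw [L_ext h]

lemma L_hom {M Z Y : BM k A} {f g : Lobj M Z ⟶ Y}
    (h : ∀ m z, f (tm M Z m z) = g (tm M Z m z)) : f = g := by
  ext x
  exact L_ext' (kl f) (kl g) h x

/-- maps out of the tensor product -/
def Llift {M Z : BM k A} {V : Type*} [AddCommGroup V] [Module k V] (f : M →ₗ[k] Z →ₗ[k] V) :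
    Lobj M Z →ₗ[k] V := TensorProduct.lift f ∘ₗ (Leq M Z).toLinearMap

@[simp] lemma Llift_tm {M Z : BM k A} {V : Type*} [AddCommGroup V] [Module k V]
    (f : M →ₗ[k] Z →ₗ[k] V) (m : M) (z : Z) : Llift f (tm M Z m z) = f m z := by
  simp [Llift, Leq_tm]

/-- morphisms out of the tensor product -/
def mkHomL {M Z Y : BM k A} (f : M →ₗ[k] Z →ₗ[k] Y)
    (hl : ∀ a m z, f (lHom M a m) z = lHom Y a (f m z))
    (hr : ∀ b m z, f m (rHom Z b z) = rHom Y b (f m z)) : Lobj M Z ⟶ Y :=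
  mkHom (Llift f) (fun a => L_ext' (Llift f ∘ₗ lHom _ a) (lHom _ a ∘ₗ Llift f)
      fun m z => by simp [hl])
    (fun b => L_ext' (Llift f ∘ₗ rHom _ b) (rHom _ b ∘ₗ Llift f) fun m z => by simp [hr])

@[simp] lemma mkHomL_tm {M Z Y : BM k A} (f : M →ₗ[k] Z →ₗ[k] Y) (hl hr) (m : M) (z : Z) :
    mkHomL f hl hr (tm M Z m z) = f m z := by
  rw [mkHomL, mkHom_apply, Llift_tm]

/-- functoriality of the tensor product -/
def Lmap (M : BM k A) {Z Z' : BM k A} (g : Z ⟶ Z') : Lobj M Z ⟶ Lobj M Z' :=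
  mkHomL ((tm M Z').compl₂ (kl g)) (fun a m z => by simp) (fun b m z => by simp [map_r])

@[simp] lemma Lmap_tm (M : BM k A) {Z Z' : BM k A} (g : Z ⟶ Z') (m : M) (z : Z) :
    Lmap M g (tm M Z m z) = tm M Z' m (g z) :=
  mkHomL_tm _ _ _ m z

/-- the functor -/
def LF (M : BM k A) : BM k A ⥤ BM k A where
  obj Z := Lobj M Z
  map g := Lmap M g
  map_id Z := L_hom fun m z => by simp
  map_comp f g := L_hom fun m z => by simp

lemma Lmap_add (M : BM k A) {X Y : BM k A} (f g : X ⟶ Y) :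
    Lmap M (f + g) = Lmap M f + Lmap M g := L_hom fun m z => by simp

instance (M : BM k A) : (LF M).Additive where
  map_add {_ _ f g} := Lmap_add M f g

lemma Leq_Lmap (M : BM k A) {X Y : BM k A} (g : X ⟶ Y) (x : Lobj M X) :
    Leq M Y (Lmap M g x) = (kl g).lTensor M (Leq M X x) :=
  L_ext' ((Leq M Y).toLinearMap ∘ₗ kl (Lmap M g)) ((kl g).lTensor M ∘ₗ (Leq M X).toLinearMap)
    (fun m z => by simp [Leq_tm]) x

lemma LF_map_short (M : BM k A) (S : ShortComplex (BM k A)) (hS : S.ShortExact) :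
    (S.map (LF M)).ShortExact := by
  have hm : Function.Injective (kl S.f) := (ModuleCat.mono_iff_injective S.f).1 hS.mono_f
  have he : Function.Surjective (kl S.g) := (ModuleCat.epi_iff_surjective S.g).1 hS.epi_g
  have hx : Function.Exact (kl S.f) (kl S.g) :=
    (ShortComplex.ShortExact.moduleCat_exact_iff_function_exact S).1 hS.exact
  have hm' := Module.Flat.lTensor_preserves_injective_linearMap (M := M) (kl S.f) hm
  have he' := LinearMap.lTensor_surjective M he
  have hx' := lTensor_exact M hx he
  apply ModuleCat.shortComplex_shortExact
  · intro (y : Lobj M S.X₂)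
    change Lmap M S.g y = 0 ↔ ∃ x : Lobj M S.X₁, Lmap M S.f x = y
    rw [← (Leq M S.X₃).map_eq_zero_iff, Leq_Lmap, hx' (Leq M S.X₂ y)]
    constructor
    · rintro ⟨x, hx⟩
      refine ⟨(Leq M S.X₁).symm x, (Leq M S.X₂).injective ?_⟩
      rw [Leq_Lmap, LinearEquiv.apply_symm_apply, hx]
    · rintro ⟨x, rfl⟩
      exact ⟨Leq M S.X₁ x, (Leq_Lmap M S.f x).symm⟩
  · intro (x : Lobj M S.X₁) (y : Lobj M S.X₁) hxy
    replace hxy : Lmap M S.f x = Lmap M S.f y := hxy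
    apply (Leq M S.X₁).injective
    apply hm'
    rw [← Leq_Lmap, hxy, Leq_Lmap]
  · intro (y : Lobj M S.X₃)
    obtain ⟨x, hx⟩ := he' (Leq M S.X₃ y)
    refine ⟨(Leq M S.X₂).symm x, ?_⟩
    apply (Leq M S.X₃).injective
    change Leq M S.X₃ (Lmap M S.g _) = _
    rw [Leq_Lmap, LinearEquiv.apply_symm_apply, hx]

instance LF_lim (M : BM k A) : PreservesFiniteLimits (LF M) :=
  (((Functor.exact_tfae (LF M)).out 0 3 rfl rfl).1 (LF_map_short M)).1

instance LF_colim (M : BM k A) : PreservesFiniteColimits (LF M) :=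
  (((Functor.exact_tfae (LF M)).out 0 3 rfl rfl).1 (LF_map_short M)).2

/-! ### left-projectivity -/

lemma LP_N0 : LP (N0 k A) := by
  intro X Y f hf h
  obtain ⟨x, hx⟩ := hf (ev h (oneN k A))
  have hl : ∀ a m, ((actL X).flip x ∘ₗ (eN k A).toLinearMap) (lHom _ a m) =
      lHom X a (((actL X).flip x ∘ₗ (eN k A).toLinearMap) m) := fun a m => by simp
  refine ⟨hmk _ hl, ?_⟩
  apply ev_inj
  intro m
  simp only [ev_hcov, ev_hmk, LinearMap.comp_apply, LinearEquiv.coe_coe, LinearMap.flip_apply,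
    actL_apply, map_l, hx]
  rw [← ev_left, l_one]

lemma LP_L {M : BM k A} (hM : LP M) (N : BM k A) : LP (Lobj M N) := by
  intro X Y f hf h
  have hsurj : Function.Surjective (kl (hcov M f)) := hM X Y f hf
  obtain ⟨s, hs⟩ := LinearMap.exists_rightInverse_of_surjective _ (LinearMap.range_eq_top.2 hsurj)
  have hc : ∀ v a m, ((tm M N).compr₂ (ev h)).flip v (lHom M a m) =
      lHom Y a (((tm M N).compr₂ (ev h)).flip v m) := fun v a m => by
    simp [← l_tm, ev_left]
  let c : N →ₗ[k] Hobj M Y := hmkL (((tm M N).compr₂ (ev h)).flip) hc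
  have hcv : ∀ n m, ev (c n) m = ev h (tm M N m n) := fun n m => by
    simp only [c, ev_hmkL]; rfl
  let q : M →ₗ[k] N →ₗ[k] X := (ev ∘ₗ s ∘ₗ c).flip
  have hq : ∀ m n, q m n = ev (s (c n)) m := fun m n => rfl
  have hleft : ∀ a x, Llift q (lHom _ a x) = lHom X a (Llift q x) := fun a =>
    L_ext' (Llift q ∘ₗ lHom _ a) (lHom _ a ∘ₗ Llift q) fun m z => by simp [hq, ev_left]
  refine ⟨hmk (Llift q) hleft, ?_⟩
  apply ev_inj
  intro x
  rw [ev_hcov, ev_hmk]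
  refine L_ext' (kl f ∘ₗ Llift q) (ev h) (fun m n => ?_) x
  have h1 := LinearMap.congr_fun hs (c n)
  have h2 := congrArg (fun y => ev y m) h1
  simp only [LinearMap.comp_apply, kl_apply, ev_hcov, LinearMap.id_apply, hcv] at h2
  simp [hq, h2]

lemma proj_L {M : BM k A} (hM : LP M) : Projective (Lobj M (N0 k A)) where
  factors {X Y} g e he := by
    have he' := (ModuleCat.epi_iff_surjective _).1 he
    have h0 : ∀ a m, (kl g ∘ₗ (tm M (N0 k A)).flip (oneN k A)) (lHom M a m) =
        lHom Y a ((kl g ∘ₗ (tm M (N0 k A)).flip (oneN k A)) m) := fun a m => by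
      simp [← l_tm, map_l]
    obtain ⟨h', hh'⟩ := hM X Y e he' (hmk _ h0)
    have hv : ∀ m, e (ev h' m) = g (tm M (N0 k A) m (oneN k A)) := fun m => by
      have := congrArg (fun y => ev y m) hh'
      simpa using this
    let q : M →ₗ[k] N0 k A →ₗ[k] X := ((actR X ∘ₗ (eN k A).toLinearMap).flip) ∘ₗ ev h'
    have hq : ∀ m n, q m n = rHom X (MulOpposite.op (eN k A n)) (ev h' m) := fun m n => rfl
    have hql : ∀ a m z, q (lHom M a m) z = lHom X a (q m z) := fun a m z => by
      simp [hq, ev_left, lr_comm]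
    have hqr : ∀ b m z, q m (rHom _ b z) = rHom X b (q m z) := fun b m z => by simp [hq]
    refine ⟨mkHomL q hql hqr, ?_⟩
    apply L_hom
    intro m n
    change e (mkHomL q hql hqr (tm M (N0 k A) m n)) = _
    refine (congrArg e (mkHomL_tm q hql hqr m n)).trans ?_
    rw [hq, map_r, hv, ← map_r, r_tm, r_one]

/-! ### the standard presentation -/

/-- the action map -/
def pM (M : BM k A) : Lobj M (N0 k A) ⟶ M :=
  mkHomL (actR M ∘ₗ (eN k A).toLinearMap).flip (fun a m z => by simp [lr_comm])
    (fun b m z => by simp)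

@[simp] lemma pM_tm (M : BM k A) (m : M) (n : N0 k A) :
    pM M (tm M _ m n) = rHom M (MulOpposite.op (eN k A n)) m :=
  mkHomL_tm _ _ _ m n

/-- left-linear section -/
def sM (M : BM k A) : M →ₗ[k] Lobj M (N0 k A) := (tm M (N0 k A)).flip (oneN k A)

@[simp] lemma pM_sM (M : BM k A) (m : M) : pM M (sM M m) = m := by
  simp [sM]

lemma sM_l (M : BM k A) (a : A) (m : M) : sM M (lHom M a m) = lHom _ a (sM M m) := by
  simp [sM]

lemma exists_K_aux (P M : BM k A) (p : P ⟶ M) (s : M →ₗ[k] P) (hps : ∀ m, p (s m) = m)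
    (hsl : ∀ a m, s (lHom M a m) = lHom P a (s m)) : ∃ (K : BM k A) (i : K ⟶ P)
    (ρ : P →ₗ[k] K), i ≫ p = 0 ∧ (∀ a x, ρ (lHom _ a x) = lHom _ a (ρ x)) ∧
      (∀ x, i (ρ x) = x - s (p x)) ∧ (∀ y, ρ (i y) = y) := by
  let K : BM k A := ModuleCat.of _ (LinearMap.ker p.hom)
  let i : K ⟶ P := ModuleCat.ofHom (LinearMap.ker p.hom).subtype
  have hi : Function.Injective (kl i) := fun x y h => Subtype.ext h
  have h0 : i ≫ p = 0 := by
    ext x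
    exact x.2
  have hr : ∀ x, p (x - s (p x)) = 0 := fun x => by
    rw [map_sub, hps, sub_self]
  let r : P → K := fun x => (⟨x - s (p x), hr x⟩ : LinearMap.ker p.hom)
  have hir : ∀ x, kl i (r x) = x - s (kl p x) := fun x => rfl
  refine ⟨K, i,
    { toFun := r
      map_add' := fun x y => hi ?_
      map_smul' := fun c x => hi ?_ }, h0, ?_, ?_, ?_⟩
  · rw [map_add, hir, hir, hir, map_add, map_add]; abel
  · rw [RingHom.id_apply, map_smul, hir, hir, map_smul, map_smul, smul_sub]
  · intro a x
    apply hi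
    change kl i (r _) = i (lHom _ a (r x))
    rw [map_l, ← kl_apply, hir, hir, map_sub, ← hsl, kl_apply, kl_apply, map_l]
  · intro x
    exact hir x
  · intro y
    apply hi
    change kl i (r _) = _
    rw [hir, kl_apply, kl_apply, show p (i y) = 0 from y.2, map_zero, sub_zero]

lemma exists_K (M : BM k A) : ∃ (K : BM k A) (i : K ⟶ Lobj M (N0 k A))
    (ρ : Lobj M (N0 k A) →ₗ[k] K), i ≫ pM M = 0 ∧ (∀ a x, ρ (lHom _ a x) = lHom _ a (ρ x)) ∧
      (∀ x, i (ρ x) = x - sM M (pM M x)) ∧ (∀ y, ρ (i y) = y) :=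
  exists_K_aux _ _ (pM M) (sM M) (pM_sM M) (sM_l M)

/-! ### vanishing -/

/-- auxiliary map -/
def τV₀ (M Z : BM k A) : Z →ₗ[k] Lobj M (N0 k A) →ₗ[k] Lobj M Z where
  toFun z := Llift ((tm M Z).compl₂ ((actL Z).flip z ∘ₗ (eN k A).toLinearMap))
  map_add' x y := L_ext fun m n => by simp
  map_smul' c x := L_ext fun m n => by simp

@[simp] lemma τV₀_tm (M Z : BM k A) (z : Z) (m : M) (n : N0 k A) :
    τV₀ M Z z (tm M _ m n) = tm M Z m (lHom Z (eN k A n) z) := by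
  simp [τV₀]

/-- auxiliary map -/
def τV₁ (M Z : BM k A) : Z ⟶ Hobj (Lobj M (N0 k A)) (Lobj M Z) :=
  toH (τV₀ M Z)
    (fun x a => L_ext' (τV₀ M Z x ∘ₗ lHom _ a) (lHom _ a ∘ₗ τV₀ M Z x) fun m n => by simp)
    (fun x a => L_ext' (τV₀ M Z (lHom _ a x)) (τV₀ M Z x ∘ₗ rHom _ (MulOpposite.op a))
      fun m n => by simp)
    (fun x b => L_ext' (τV₀ M Z (rHom _ b x)) (rHom _ b ∘ₗ τV₀ M Z x)
      fun m n => by simp [lr_comm])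

@[simp] lemma ev_τV₁ (M Z : BM k A) (z : Z) (m : M) (n : N0 k A) :
    ev (τV₁ M Z z) (tm M _ m n) = tm M Z m (lHom Z (eN k A n) z) :=
  (ev_toH _ _ _ _ z _).trans (τV₀_tm M Z z m n)

lemma hom_evL {M N X Y : BM k A} {f g : X ⟶ Hobj (Lobj M N) Y}
    (h : ∀ x m n, ev (f x) (tm M N m n) = ev (g x) (tm M N m n)) : f = g :=
  hom_ev fun x => L_ext' _ _ (h x)

/-- unit -/
def τV (M : BM k A) : 𝟭 (BM k A) ⟶ LF M ⋙ HF (Lobj M (N0 k A)) where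
  app Z := τV₁ M Z
  naturality X Y f := by
    change f ≫ τV₁ M Y = τV₁ M X ≫ hcov _ (Lmap M f)
    exact hom_evL fun x m n => by simp [map_l]

/-- evaluation at the unit -/
def εV (M Y : BM k A) : Lobj M (Hobj (Lobj M (N0 k A)) Y) ⟶ Y :=
  mkHomL ((ev (M := Lobj M (N0 k A)) (X := Y)).flip ∘ₗ sM M)
    (fun a m z => by simp [sM_l, ev_left]) (fun b m z => by simp)

@[simp] lemma εV_tm (M Y : BM k A) (m : M) (h : Hobj (Lobj M (N0 k A)) Y) :
    εV M Y (tm M _ m h) = ev h (tm M _ m (oneN k A)) :=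
  mkHomL_tm _ _ _ m h

lemma τε (M Y : BM k A) : τV₁ M (Hobj (Lobj M (N0 k A)) Y) ≫ hcov _ (εV M Y) = 𝟙 _ :=
  hom_evL fun x m n => by simp [r_one]

/-! ### degree zero -/

/-- a bimodule map `M → A` acts -/
def τφ (M : BM k A) (φ : M →ₗ[k] A) (hl : ∀ a m, φ (lHom M a m) = a * φ m)
    (hr : ∀ b m, φ (rHom M b m) = φ m * b.unop) (X : BM k A) : X ⟶ Hobj M X :=
  toH (actL X ∘ₗ φ).flip (fun x a m => by simp [hl]) (fun x a m => by simp [hr])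
    (fun x b m => by simp [lr_comm])

@[simp] lemma ev_τφ (M : BM k A) (φ : M →ₗ[k] A) (hl hr) (X : BM k A) (x : X) (m : M) :
    ev (τφ M φ hl hr X x) m = lHom X (φ m) x :=
  ev_toH _ _ _ _ x m

/-- the natural transformation -/
def τΦ (M : BM k A) (φ : M →ₗ[k] A) (hl : ∀ a m, φ (lHom M a m) = a * φ m)
    (hr : ∀ b m, φ (rHom M b m) = φ m * b.unop) : 𝟭 (BM k A) ⟶ HF M where
  app X := τφ M φ hl hr X
  naturality X Y f := by
    change f ≫ τφ M φ hl hr Y = τφ M φ hl hr X ≫ hcov M f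
    exact hom_ev fun x m => by simp [map_l]

lemma exists_tau (M : BM k A) (g : N0 k A ⟶ Hobj M (N0 k A)) :
    ∃ τ : 𝟭 (BM k A) ⟶ HF M, τ.app (N0 k A) = g := by
  have h1 : ∀ a : A, lHom _ a (oneN k A) = rHom _ (MulOpposite.op a) (oneN k A) := fun a => by
    apply (eN k A).injective; simp
  have h2 : ∀ b m, ev (g (oneN k A)) (rHom M b m) = rHom _ b (ev (g (oneN k A)) m) :=
    fun b m => by
      have := ev_l (g (oneN k A)) b.unop m
      rw [MulOpposite.op_unop] at this
      rw [← this, ← map_l, h1, map_r, ev_r, MulOpposite.op_unop]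
  let φ : M →ₗ[k] A := (eN k A).toLinearMap ∘ₗ ev (g (oneN k A))
  have hφ : ∀ m, φ m = eN k A (ev (g (oneN k A)) m) := fun m => rfl
  have hl : ∀ a m, φ (lHom M a m) = a * φ m := fun a m => by simp [hφ, ev_left]
  have hr : ∀ b m, φ (rHom M b m) = φ m * b.unop := fun b m => by simp [hφ, h2]
  refine ⟨τΦ M φ hl hr, ?_⟩
  change τφ M φ hl hr (N0 k A) = g
  refine hom_ev fun x m => ?_
  rw [ev_τφ]
  conv_rhs => rw [← r_one x, map_r, ev_r]
  apply (eN k A).injective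
  simp [hφ]

lemma tau_iso : IsIso ((τΦ (N0 k A) (eN k A).toLinearMap (by simp) (by simp)).app (N0 k A)) := by
  change IsIso (τφ (N0 k A) (eN k A).toLinearMap (by simp) (by simp) (N0 k A))
  refine (ConcreteCategory.isIso_iff_bijective _).2 ⟨fun x y hxy => ?_, fun h => ?_⟩
  · have := congrArg (fun t => ev t (oneN k A)) hxy
    simpa using this
  · refine ⟨ev h (oneN k A), ev_inj fun m => ?_⟩
    rw [ev_τφ, ← ev_left]
    simp [l_one]

/-! ### main induction -/

lemma good_all (m : ℕ) : ∀ (M : BM k A) (hM : LP M),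
    letI := HF_lim hM; letI := HF_colim hM; Good (N0 k A) (HF M) m := by
  induction m with
  | zero =>
    intro M hM
    letI := HF_lim hM
    letI := HF_colim hM
    exact good_zero _ _ (exists_tau M)
  | succ m ih =>
    intro M hM
    letI := HF_lim hM
    letI := HF_colim hM
    have hP := LP_L hM (N0 k A)
    letI := HF_lim hP
    letI := HF_colim hP
    obtain ⟨K, i, ρ, h0, hρl, hiρ, hρi⟩ := exists_K M
    have hi_surj : ∀ X, Function.Surjective (hcon i X) := fun X h => by
      have hl : ∀ a x, (ev h ∘ₗ ρ) (lHom _ a x) = lHom X a ((ev h ∘ₗ ρ) x) := fun a x => by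
        simp [hρl, ev_left]
      exact ⟨hmk _ hl, ev_inj fun y => by simp [hρi]⟩
    have hK : LP K := by
      intro X Y f hf h
      obtain ⟨h2, rfl⟩ := hi_surj Y h
      obtain ⟨g, rfl⟩ := hP X Y f hf h2
      refine ⟨hcon i X g, ?_⟩
      exact (congrArg (fun t => t g) (congrArg (fun t => (ConcreteCategory.hom t))
        (hcov_hcon i f))).symm
    letI := HF_lim hK
    letI := HF_colim hK
    have hip : ∀ y, pM M (i y) = 0 := fun y => by
      have := congrArg (fun t => (ConcreteCategory.hom t) y) h0
      simpa using this
    have z : ∀ X, (HFcon (pM M)).app X ≫ (HFcon i).app X = 0 := fun X => by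
      change hcon (pM M) X ≫ hcon i X = 0
      exact hom_ev fun h y => by simp [hip]
    refine good_succ _ (HF M) (HF (Lobj M (N0 k A))) (HF K) (HFcon (pM M)) (HFcon i) z ?_ m ?_
      (ih K hK)
    · intro X
      apply ModuleCat.shortComplex_shortExact
      · intro (h : Hobj (Lobj M (N0 k A)) X)
        change hcon i X h = 0 ↔ ∃ g : Hobj M X, hcon (pM M) X g = h
        constructor
        · intro hh
          have hl : ∀ a x, (ev h ∘ₗ sM M) (lHom _ a x) = lHom X a ((ev h ∘ₗ sM M) x) :=
            fun a x => by simp [sM_l, ev_left]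
          refine ⟨hmk _ hl, ev_inj fun x => ?_⟩
          have h2 : ev h (i (ρ x)) = 0 := by
            rw [← ev_hcon, hh]; simp
          rw [hiρ, map_sub, sub_eq_zero] at h2
          simp [h2]
        · rintro ⟨g, rfl⟩
          exact ev_inj fun y => by simp [hip]
      · intro (x : Hobj M X) (y : Hobj M X) hxy
        replace hxy : hcon (pM M) X x = hcon (pM M) X y := hxy
        apply ev_inj
        intro w
        have := congrArg (fun t => ev t (sM M w)) hxy
        simpa using this
      · exact hi_surj X
    · intro Ξ
      haveI : Projective ((LF M).obj (N0 k A)) := proj_L hM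
      exact vanish (N0 k A) (N0 k A) (LF M) (HF (Lobj M (N0 k A))) (τV M) (εV M _) (τε M _) m Ξ

lemma gc_N0 (m n : ℕ) (ξ : Abelian.Ext (N0 k A) (N0 k A) m)
    (η : Abelian.Ext (N0 k A) (N0 k A) n) :
    η.comp ξ (Nat.add_comm n m) = ((-1 : ℤ) ^ (m * n)) • ξ.comp η rfl := by
  have hM := LP_N0 (k := k) (A := A)
  letI := HF_lim hM
  letI := HF_colim hM
  haveI := tau_iso (k := k) (A := A)
  exact graded_comm_of_good (N0 k A) (HF (N0 k A))
    (τΦ (N0 k A) (eN k A).toLinearMap _ _) m (good_all m (N0 k A) hM) n ξ η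

end Concrete


theorem gerstenhaber_graded_commutativity (m n : ℕ)
    (ξ : Abelian.Ext (ModuleCat.of (A ⊗[k] Aᵐᵒᵖ) A) (ModuleCat.of (A ⊗[k] Aᵐᵒᵖ) A) m)
    (η : Abelian.Ext (ModuleCat.of (A ⊗[k] Aᵐᵒᵖ) A) (ModuleCat.of (A ⊗[k] Aᵐᵒᵖ) A) n) :
    η.comp ξ (Nat.add_comm n m) = ((-1 : ℤ) ^ (m * n)) • ξ.comp η rfl := by
  exact gc_N0 m n ξ η
end
end

section
/- (Koszul duality for the exterior algebra.) Let k be a field of characteristic zero, V a finite-dimensional k-vector space, Λ = ⋀V the exterior algebra of V, and k_∧ = Λ/Λ^{≥1} the augmentation (trivial) left Λ-module. Then there exists a family of k-linear isomorphisms φ_i : Sym^i(V*) → Ext^i_Λ(k_∧, k_∧), i ≥ 0, such that φ_0(1) is the identity of k_∧ and φ_{i+j}(p·q) = φ_i(p) ∘ φ_j(q) for all p ∈ Sym^i(V*), q ∈ Sym^j(V*), where ∘ is Yoneda composition. In other words, the Ext-algebra ⊕_i Ext^i_Λ(k_∧,k_∧) with the Yoneda product is isomorphic as a graded k-algebra to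 the symmetric algebra Sym(V*) with Sym^i placed in degree i. -/
open CategoryTheory
open scoped TensorProduct

noncomputable section

attribute [local instance] HasDerivedCategory.standard

universe u

variable (k : Type u) [Field k] [CharZero k]
variable (V : Type u) [AddCommGroup V] [Module k V] [FiniteDimensional k V]

/-- The augmentation (trivial) module `k_∧ = Λ/Λ^{≥1}` over the exterior algebra
`Λ = ⋀V`, on which `V` acts by `0` (via the augmentation `Λ → k`). -/
instance : Module (ExteriorAlgebra k V) k :=
  Module.compHom k (ExteriorAlgebra.algebraMapInv (R := k) (M := V)).toRingHom

instance : HasExt.{u+1} (ModuleCat.{u} (ExteriorAlgebra k V)) :=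
  hasExt_of_hasDerivedCategory _


namespace KoszulAux

open Abelian

section Abstract

universe w v₁ u₁ u₂

variable {F : Type u₂} [Field F] {C : Type u₁} [Category.{v₁} C] [Abelian C] [Linear F C]
  [HasExt.{w} C]

/-- Left multiplication by `x : Ext¹(K,K)` on the product of all `Extⁱ(K, K)`. -/
def op {K : C} (x : Ext K K 1) :
    (∀ i : ℕ, Ext K K i) →ₗ[F] (∀ i : ℕ, Ext K K i) where
  toFun y := fun i => match i with
    | 0 => 0
    | i + 1 => x.comp (y i) (add_comm 1 i)
  map_add' y z := by
    funext i
    cases i <;> simp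
  map_smul' c y := by
    funext i
    cases i <;> simp

lemma op_zero {K : C} (x : Ext K K 1) (y : ∀ i : ℕ, Ext K K i) :
    op (F := F) x y 0 = 0 := rfl

lemma op_succ {K : C} (x : Ext K K 1) (y : ∀ i : ℕ, Ext K K i) (i l : ℕ) (h : 1 + i = l) :
    op (F := F) x y l = x.comp (y i) h := by
  obtain rfl : l = i + 1 := by omega
  rfl

lemma op_comm {K : C} (x y : Ext K K 1)
    (h : x.comp y (rfl : 1 + 1 = 2) = y.comp x (rfl : 1 + 1 = 2)) :
    op (F := F) x * op y = op y * op x := by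
  ext z i
  rcases i with _ | _ | i
  · rfl
  · simp only [Module.End.mul_apply]
    rw [op_succ x _ 0 1 rfl, op_succ y _ 0 1 rfl, op_zero, op_zero]
    simp
  · have h2 : 2 + i = i + 1 + 1 := by omega
    have h1 : 1 + i = i + 1 := by omega
    have h3 : 1 + (i + 1) = i + 1 + 1 := by omega
    simp only [Module.End.mul_apply]
    rw [op_succ x _ (i + 1) (i + 1 + 1) h3, op_succ y _ (i + 1) (i + 1 + 1) h3,
      op_succ x _ i (i + 1) h1, op_succ y _ i (i + 1) h1,
      ← Ext.comp_assoc x y (z i) (rfl : 1 + 1 = 2) h1 (by omega), h,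
      Ext.comp_assoc y x (z i) (rfl : 1 + 1 = 2) h1 (by omega)]

open scoped IsMulCommutative in
/-- The algebra map given by commuting elements. -/
lemma exists_algHom {n : ℕ} {A : Type*} [Ring A] [Algebra F A] (x : Fin n → A)
    (hx : ∀ a b, x a * x b = x b * x a) :
    ∃ P : MvPolynomial (Fin n) F →ₐ[F] A, ∀ a, P (MvPolynomial.X a) = x a := by
  have hc : ∀ a ∈ Set.range x, ∀ b ∈ Set.range x, a * b = b * a := by
    rintro _ ⟨a, rfl⟩ _ ⟨b, rfl⟩
    exact hx a b
  have := Algebra.isMulCommutative_adjoin F hc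
  let g : Fin n → Algebra.adjoin F (Set.range x) :=
    fun a => ⟨x a, Algebra.subset_adjoin ⟨a, rfl⟩⟩
  let f : MvPolynomial (Fin n) F →ₐ[F] Algebra.adjoin F (Set.range x) := MvPolynomial.aeval g
  refine ⟨(Algebra.adjoin F (Set.range x)).val.comp f, fun a => ?_⟩
  simp [f, g]

/-- The unit of the product of all Ext groups. -/
def unitExt (K : C) : ∀ i : ℕ, Ext K K i := fun i => match i with
  | 0 => Ext.mk₀ (𝟙 K)
  | _ + 1 => 0

variable {n : ℕ} {K : C} (x : Fin n → Ext K K 1)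
  (P : MvPolynomial (Fin n) F →ₐ[F] Module.End F (∀ i : ℕ, Ext K K i))

/-- The component of degree `i`. -/
def phi (i : ℕ) : MvPolynomial (Fin n) F →ₗ[F] Ext K K i where
  toFun p := P p (unitExt K) i
  map_add' p q := by simp
  map_smul' c p := by simp

lemma phi_one : phi P 0 1 = Ext.mk₀ (𝟙 K) := by
  simp [phi, unitExt]

variable (hP : ∀ a, P (MvPolynomial.X a) = op (x a))
include hP

lemma phi_X_mul (a : Fin n) (p : MvPolynomial (Fin n) F) (i l : ℕ) (h : 1 + i = l) :
    phi P l (MvPolynomial.X a * p) = (x a).comp (phi P i p) h := by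
  simp only [phi, LinearMap.coe_mk, AddHom.coe_mk, map_mul, hP, Module.End.mul_apply]
  exact op_succ _ _ _ _ h

lemma monomial_apply (i : ℕ) : ∀ (s : Fin n →₀ ℕ), s.degree = i →
    ∀ (y : ∀ i : ℕ, Ext K K i) (j l : ℕ) (h : i + j = l),
    P (MvPolynomial.monomial s 1) y l =
      (phi P i (MvPolynomial.monomial s 1)).comp (y j) h := by
  induction i with
  | zero =>
    intro s hs y j l h
    obtain rfl : s = 0 := (Finsupp.degree_eq_zero_iff s).mp hs
    obtain rfl : j = l := by omega
    have : (MvPolynomial.monomial (0 : Fin n →₀ ℕ) (1 : F)) = 1 := rfl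
    rw [this, phi_one]
    simp
  | succ i ih =>
    intro s hs y j l h
    have hne : s ≠ 0 := by rintro rfl; simp at hs
    obtain ⟨a, ha⟩ : ∃ a, s a ≠ 0 := by
      by_contra hh
      push Not at hh
      exact hne (Finsupp.ext hh)
    obtain ⟨t, rfl⟩ : ∃ t, s = Finsupp.single a 1 + t :=
      ⟨s - Finsupp.single a 1, by
        rw [add_tsub_cancel_of_le]
        simpa using Nat.one_le_iff_ne_zero.mpr ha⟩
    have ht : t.degree = i := by
      rw [map_add, Finsupp.degree_single] at hs
      omega
    have e : MvPolynomial.monomial (Finsupp.single a 1 + t) (1 : F) =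
        MvPolynomial.X a * MvPolynomial.monomial t 1 := by
      rw [MvPolynomial.X, MvPolynomial.monomial_mul, one_mul]
    rw [e, phi_X_mul x P hP a _ i (i + 1) (by omega)]
    rw [map_mul, Module.End.mul_apply, hP, op_succ _ _ (i + j) l (by omega),
      ih t ht y j (i + j) rfl, ← Ext.comp_assoc]
    omega

lemma hom_apply (i : ℕ) (p : MvPolynomial (Fin n) F) (hp : p.IsHomogeneous i)
    (y : ∀ i : ℕ, Ext K K i) (j l : ℕ) (h : i + j = l) :
    P p y l = (phi P i p).comp (y j) h := by
  have key : ∀ s ∈ p.support, P (MvPolynomial.monomial s (p.coeff s)) y l =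
      (phi P i (MvPolynomial.monomial s (p.coeff s))).comp (y j) h := by
    intro s hs
    have e : MvPolynomial.monomial s (p.coeff s) = p.coeff s • MvPolynomial.monomial s 1 := by
      simp [MvPolynomial.smul_monomial]
    have hs' : s.degree = i := by
      have := hp (MvPolynomial.mem_support_iff.mp hs)
      rw [Finsupp.degree_eq_weight_one]
      exact this
    rw [e, map_smul, map_smul, LinearMap.smul_apply, Pi.smul_apply,
      monomial_apply x P hP i s hs' y j l h, Ext.smul_comp]
  rw [p.as_sum, map_sum, map_sum]
  simp only [LinearMap.sum_apply, Finset.sum_apply]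
  rw [Finset.sum_congr rfl key]
  have := map_sum ((Ext.bilinearComp K K K i j l h).flip (y j))
    (fun s => phi P i (MvPolynomial.monomial s (p.coeff s))) p.support
  exact this.symm

lemma phi_mul (i j : ℕ) (p q : MvPolynomial (Fin n) F) (hp : p.IsHomogeneous i) :
    phi P (i + j) (p * q) = (phi P i p).comp (phi P j q) rfl := by
  have := hom_apply x P hP i p hp (P q (unitExt K)) j (i + j) rfl
  simpa [phi] using this

omit hP in
lemma homog_degree {i : ℕ} {p : MvPolynomial (Fin n) F} (hp : p.IsHomogeneous i)
    {s : Fin n →₀ ℕ} (hs : p.coeff s ≠ 0) : s.degree = i := by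
  have := hp hs
  rw [Finsupp.degree_eq_weight_one]
  exact this

omit hP in
lemma homog_of_degree {i : ℕ} {p : MvPolynomial (Fin n) F}
    (h : ∀ s, p.coeff s ≠ 0 → s.degree = i) : p.IsHomogeneous i := by
  intro s hs
  have := h s hs
  rw [Finsupp.degree_eq_weight_one] at this
  exact this

/-- Data of a tower of short exact sequences computing `Ext(K, K)`. -/
structure Tower (x : Fin n → Ext K K 1) where
  N : ℕ → C
  ι : ∀ j, j < n → (N (j + 1) ⟶ N j)
  p : ∀ j, j < n → (N j ⟶ N (j + 1))
  w : ∀ j hj, ι j hj ≫ p j hj = 0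
  ex : ∀ j hj, (ShortComplex.mk _ _ (w j hj)).ShortExact
  π : ∀ j, N j ⟶ K
  hp : ∀ j hj, p j hj ≫ π (j + 1) = π j
  hx : ∀ j hj, (ex j hj).extClass.comp (Ext.mk₀ (π (j + 1))) (add_zero 1) =
    (Ext.mk₀ (π (j + 1))).comp (x ⟨j, hj⟩) (zero_add 1)

namespace Tower

variable {x} (T : Tower x)

omit hP

lemma pi_x (a : Fin n) (d : ℕ) : ∀ j : ℕ, j + d = a →
    (Ext.mk₀ (T.π j)).comp (x a) (zero_add 1) = 0 := by
  induction d with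
  | zero =>
    intro j hj
    have hja : j < n := by omega
    obtain rfl : a = ⟨j, hja⟩ := Fin.ext (by simpa using hj.symm)
    rw [← T.hp j hja, ← Ext.mk₀_comp_mk₀_assoc, ← T.hx j hja]
    exact (T.ex j hja).comp_extClass_assoc _ _
  | succ d ih =>
    intro j hj
    have hja : j < n := by omega
    rw [← T.hp j hja, ← Ext.mk₀_comp_mk₀_assoc, ih (j + 1) (by omega)]
    simp

include hP

lemma conv (i j : ℕ) (f : MvPolynomial (Fin n) F) (hf : f.IsHomogeneous i)
    (h : ∀ s, f.coeff s ≠ 0 → ∃ a : Fin n, j ≤ a ∧ s a ≠ 0) :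
    (Ext.mk₀ (T.π j)).comp (phi P i f) (zero_add i) = 0 := by
  have key : ∀ s ∈ f.support, phi P i (MvPolynomial.monomial s (f.coeff s)) ∈
      LinearMap.ker (Ext.precompOfLinear (Ext.mk₀ (T.π j)) F K (zero_add i)) := by
    intro s hs
    obtain ⟨a, hja, ha⟩ := h s (MvPolynomial.mem_support_iff.mp hs)
    have hd := homog_degree hf (MvPolynomial.mem_support_iff.mp hs)
    obtain ⟨t, rfl⟩ : ∃ t, s = Finsupp.single a 1 + t :=
      ⟨s - Finsupp.single a 1, by
        rw [add_tsub_cancel_of_le]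
        simpa using Nat.one_le_iff_ne_zero.mpr ha⟩
    have ht : 1 + t.degree = i := by
      rwa [map_add, Finsupp.degree_single] at hd
    have e : MvPolynomial.monomial (Finsupp.single a 1 + t)
          (f.coeff (Finsupp.single a 1 + t)) =
        MvPolynomial.X a * MvPolynomial.monomial t (f.coeff (Finsupp.single a 1 + t)) := by
      rw [MvPolynomial.X, MvPolynomial.monomial_mul, one_mul]
    rw [LinearMap.mem_ker, e, phi_X_mul x P hP a _ t.degree i ht]
    change (Ext.mk₀ (T.π j)).comp _ (zero_add i) = 0
    rw [← Ext.comp_assoc _ _ _ (zero_add 1) _ (by omega),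
      T.pi_x a (a - j) j (by omega), Ext.zero_comp]
  have := Submodule.sum_mem _ key
  rw [← map_sum, ← f.as_sum] at this
  exact this

/-- The inductive claim. -/
def Claim (T : Tower x) (i j : ℕ) : Prop :=
  (∀ y : Ext (T.N j) K i, ∃ f : MvPolynomial (Fin n) F, f.IsHomogeneous i ∧
    (Ext.mk₀ (T.π j)).comp (phi P i f) (zero_add i) = y) ∧
  (∀ f : MvPolynomial (Fin n) F, f.IsHomogeneous i →
    (Ext.mk₀ (T.π j)).comp (phi P i f) (zero_add i) = 0 →
    ∀ s, f.coeff s ≠ 0 → ∃ a : Fin n, j ≤ a ∧ s a ≠ 0)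

omit hP in
lemma claim_base [Projective (T.N 0)] (h0 : ∀ f : T.N 0 ⟶ K, ∃ c : F, f = c • T.π 0)
    (h1 : ∀ c : F, c • T.π 0 = 0 → c = 0) (i : ℕ) : Claim P T i 0 := by
  have hc : ∀ c : F, (Ext.mk₀ (T.π 0)).comp (phi P 0 (MvPolynomial.C c)) (zero_add 0) =
      Ext.mk₀ (c • T.π 0) := by
    intro c
    have : (MvPolynomial.C c : MvPolynomial (Fin n) F) = c • 1 := by
      simp [MvPolynomial.smul_eq_C_mul]
    rw [this, map_smul, phi_one, Ext.mk₀_smul]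
    simp
  rcases i with _ | i
  · constructor
    · intro y
      obtain ⟨f, rfl⟩ := (Ext.mk₀_bijective _ _).2 y
      obtain ⟨c, rfl⟩ := h0 f
      exact ⟨MvPolynomial.C c, MvPolynomial.isHomogeneous_C _ _, hc c⟩
    · intro f hf hz s hs
      exfalso
      obtain rfl : s = 0 := (Finsupp.degree_eq_zero_iff s).mp (homog_degree hf hs)
      have hf' : f = MvPolynomial.C (f.coeff 0) := by
        ext t
        rw [MvPolynomial.coeff_C]
        split_ifs with ht
        · rw [ht]
        · by_contra hh
          exact ht ((Finsupp.degree_eq_zero_iff t).mp (homog_degree hf hh)).symm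
      rw [hf', hc, Ext.mk₀_eq_zero_iff] at hz
      exact hs (h1 _ hz)
  · constructor
    · intro y
      refine ⟨0, MvPolynomial.isHomogeneous_zero _ _ _, ?_⟩
      rw [Ext.eq_zero_of_projective y]
      exact Ext.eq_zero_of_projective _
    · intro f hf _ s hs
      have hd := homog_degree hf hs
      by_contra! hh
      have : s = 0 := Finsupp.ext fun a => hh a (Nat.zero_le _)
      rw [this] at hd
      simp at hd

lemma pi_phi_X (j : ℕ) (hj : j < n) (i l : ℕ) (hl : 1 + i = l) (h : MvPolynomial (Fin n) F) :
    (Ext.mk₀ (T.π (j + 1))).comp (phi P l (MvPolynomial.X ⟨j, hj⟩ * h)) (zero_add l) =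
      (T.ex j hj).extClass.comp ((Ext.mk₀ (T.π (j + 1))).comp (phi P i h) (zero_add i)) hl := by
  rw [phi_X_mul x P hP _ h i l hl, ← Ext.comp_assoc _ _ _ (zero_add 1) _ (by omega),
    ← T.hx j hj, Ext.comp_assoc]
  omega

lemma claim_step (j : ℕ) (hj : j < n) (ih : ∀ i, Claim P T i j) (i : ℕ) :
    Claim P T i (j + 1) := by
  have down : ∀ i f, (Ext.mk₀ (T.π j)).comp (phi P i f) (zero_add i) =
      (Ext.mk₀ (T.p j hj)).comp ((Ext.mk₀ (T.π (j + 1))).comp (phi P i f) (zero_add i))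
        (zero_add i) := by
    intro i f
    rw [Ext.mk₀_comp_mk₀_assoc, T.hp]
  induction i with
  | zero =>
    constructor
    · intro y
      obtain ⟨f, hf, hy⟩ := (ih 0).1 ((Ext.mk₀ (T.p j hj)).comp y (zero_add 0))
      refine ⟨f, hf, ?_⟩
      rw [down] at hy
      have := (T.ex j hj).epi_g
      exact Ext.precomp_mk₀_injective_of_epi K (T.p j hj) hy
    · intro f hf hz s hs
      have := (ih 0).2 f hf (by rw [down, hz]; simp) s hs
      obtain ⟨a, _, ha⟩ := this
      rw [(Finsupp.degree_eq_zero_iff s).mp (homog_degree hf hs)] at ha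
      simp at ha
  | succ i ihi =>
    have h1i : 1 + i = i + 1 := add_comm _ _
    constructor
    · intro y
      obtain ⟨f, hf, hy⟩ := (ih (i + 1)).1 ((Ext.mk₀ (T.p j hj)).comp y (zero_add _))
      rw [down, ← sub_eq_zero] at hy
      have hy' : (Ext.mk₀ (T.p j hj)).comp
          (y - (Ext.mk₀ (T.π (j + 1))).comp (phi P (i + 1) f) (zero_add (i + 1)))
          (zero_add (i + 1)) = 0 := by
        rw [sub_eq_add_neg, Ext.comp_add, Ext.comp_neg, ← sub_eq_add_neg, ← neg_sub, hy, neg_zero]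
      obtain ⟨z, hz⟩ := Ext.contravariant_sequence_exact₃ (T.ex j hj) K _ hy' h1i
      obtain ⟨h, hh, rfl⟩ := ihi.1 z
      rw [← pi_phi_X P hP T] at hz
      refine ⟨f + MvPolynomial.X ⟨j, hj⟩ * h, hf.add ?_, ?_⟩
      · rw [← h1i]
        exact (MvPolynomial.isHomogeneous_X _ _).mul hh
      · rw [map_add, Ext.comp_add, hz]
        abel
    · intro f hf hz
      have hsup := (ih (i + 1)).2 f hf (by rw [down, hz]; simp)
      set a₀ : Fin n := ⟨j, hj⟩ with ha₀
      have hdec := MvPolynomial.divMonomial_add_modMonomial_single f a₀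
      set h := f.divMonomial (Finsupp.single a₀ 1) with hh
      set g := f.modMonomial (Finsupp.single a₀ 1) with hg
      have hgc : ∀ s, g.coeff s ≠ 0 → f.coeff s ≠ 0 ∧ s a₀ = 0 := by
        intro s hs
        by_cases hle : Finsupp.single a₀ 1 ≤ s
        · exact absurd (MvPolynomial.coeff_modMonomial_of_le f hle) hs
        · rw [hg, MvPolynomial.coeff_modMonomial_of_not_le f hle] at hs
          refine ⟨hs, ?_⟩
          rw [Finsupp.single_le_iff] at hle
          omega
      have hgh : g.IsHomogeneous (i + 1) :=
        homog_of_degree fun s hs => homog_degree hf (hgc s hs).1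
      have hhc : ∀ t, h.coeff t = f.coeff (Finsupp.single a₀ 1 + t) := by
        intro t
        rw [hh, MvPolynomial.coeff_divMonomial]
      have hhh : h.IsHomogeneous i := by
        refine homog_of_degree fun t ht => ?_
        rw [hhc] at ht
        have := homog_degree hf ht
        rw [map_add, Finsupp.degree_single] at this
        omega
      have ne : ∀ (s : Fin n →₀ ℕ), s a₀ = 0 → ∀ a : Fin n, j ≤ a → s a ≠ 0 → j + 1 ≤ a := by
        intro s hs a hja ha
        by_contra hlt
        have : a = a₀ := Fin.ext (by simp [ha₀]; omega)
        rw [this] at ha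
        exact ha hs
      have hg0 := T.conv P hP (i + 1) (j + 1) g hgh (by
        intro s hs
        obtain ⟨h2, h3⟩ := hgc s hs
        obtain ⟨a, hja, ha⟩ := hsup s h2
        exact ⟨a, ne s h3 a hja ha, ha⟩)
      rw [← hdec, map_add, Ext.comp_add, hg0, add_zero, pi_phi_X P hP T j hj i _ h1i] at hz
      obtain ⟨y, hy⟩ := Ext.contravariant_sequence_exact₁ (T.ex j hj) K _ h1i hz
      obtain ⟨q, hq, rfl⟩ := (ih i).1 y
      rw [down, Ext.mk₀_comp_mk₀_assoc, T.w, Ext.mk₀_zero, Ext.zero_comp] at hy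
      have hfin := ihi.2 h hhh hy.symm
      intro s hs
      by_cases hs0 : s a₀ = 0
      · obtain ⟨a, hja, ha⟩ := hsup s hs
        exact ⟨a, ne s hs0 a hja ha, ha⟩
      · obtain ⟨t, rfl⟩ : ∃ t, s = Finsupp.single a₀ 1 + t :=
          ⟨s - Finsupp.single a₀ 1, by
            rw [add_tsub_cancel_of_le]
            simpa using Nat.one_le_iff_ne_zero.mpr hs0⟩
        obtain ⟨a, hja, ha⟩ := hfin t (by rwa [hhc])
        exact ⟨a, hja, by simp [ha]⟩

lemma bij [Projective (T.N 0)] (h0 : ∀ f : T.N 0 ⟶ K, ∃ c : F, f = c • T.π 0)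
    (h1 : ∀ c : F, c • T.π 0 = 0 → c = 0) [IsIso (T.π n)] (i : ℕ) :
    (∀ y : Ext K K i, ∃ f : MvPolynomial (Fin n) F, f.IsHomogeneous i ∧ phi P i f = y) ∧
    (∀ f : MvPolynomial (Fin n) F, f.IsHomogeneous i → phi P i f = 0 → f = 0) := by
  have all : ∀ j, j ≤ n → ∀ i, Claim P T i j := by
    intro j
    induction j with
    | zero => exact fun _ i => T.claim_base P h0 h1 i
    | succ j ih => exact fun hj i => T.claim_step P hP j (by omega) (ih (by omega)) i
  obtain ⟨hs, hk⟩ := all n le_rfl i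
  constructor
  · intro y
    obtain ⟨f, hf, hy⟩ := hs ((Ext.mk₀ (T.π n)).comp y (zero_add i))
    refine ⟨f, hf, ?_⟩
    have := congrArg (fun z => (Ext.mk₀ (inv (T.π n))).comp z (zero_add i)) hy
    simpa using this
  · intro f hf hz
    ext s
    by_contra hc
    obtain ⟨a, ha, _⟩ := hk f hf (by rw [hz]; simp) s hc
    have := a.2
    omega

end Tower

omit hP

end Abstract

section Concrete

universe w v

variable {R : Type v} [Ring R] {n : ℕ} (e : Fin n → R)

/-- The left ideal generated by the `e i`, `i ∈ A`. -/
def I (A : Set (Fin n)) : Submodule R R := Submodule.span R (e '' A)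

lemma I_mono {A B : Set (Fin n)} (h : A ⊆ B) : I e A ≤ I e B :=
  Submodule.span_mono (Set.image_mono h)

lemma e_mem {A : Set (Fin n)} {m : Fin n} (h : m ∈ A) (r : R) : r * e m ∈ I e A :=
  (I e A).smul_mem r (Submodule.subset_span ⟨m, h, rfl⟩)

lemma mem_I_insert {A : Set (Fin n)} {m : Fin n} {x : R} (h : x ∈ I e (insert m A)) :
    ∃ c : R, x - c * e m ∈ I e A := by
  rw [I, Set.image_insert_eq, Submodule.mem_span_insert] at h
  obtain ⟨c, z, hz, rfl⟩ := h
  exact ⟨c, by rw [smul_eq_mul, add_sub_cancel_left]; exact hz⟩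

/-- The properties of the generators that are used. -/
structure Kos : Prop where
  anti : ∀ i j, e i * e j = - (e j * e i)
  sq : ∀ i, e i * e i = 0
  key : ∀ (A : Set (Fin n)) (m : Fin n) (a : R), m ∉ A → a * e m ∈ I e A → a ∈ I e (insert m A)

variable {e}

lemma Kos.mul_mem (H : Kos e) {A B : Set (Fin n)} {m : Fin n} (hB : B ⊆ insert m A) {a : R}
    (ha : a ∈ I e B) : a * e m ∈ I e A := by
  induction ha using Submodule.span_induction with
  | mem x hx =>
    obtain ⟨i, hi, rfl⟩ := hx
    rcases hB hi with rfl | hi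
    · rw [H.sq]; exact zero_mem _
    · rw [H.anti, ← neg_mul]
      exact e_mem e hi _
  | zero => simp
  | add x y _ _ hx hy => rw [add_mul]; exact add_mem hx hy
  | smul r x _ hx => rw [smul_eq_mul, mul_assoc]; exact (I e A).smul_mem r hx

variable (e)

/-- Right multiplication by `e m`. -/
def rm (m : Fin n) : R →ₗ[R] R := LinearMap.toSpanSingleton R R (e m)

@[simp] lemma rm_apply (m : Fin n) (a : R) : rm e m a = a * e m := rfl

/-- The quotient modules. -/
abbrev Q (A : Set (Fin n)) : ModuleCat.{v} R := ModuleCat.of R (R ⧸ I e A)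

/-- The projection maps. -/
def pr {A B : Set (Fin n)} (h : A ⊆ B) : Q e A ⟶ Q e B :=
  ModuleCat.ofHom (Submodule.mapQ _ _ LinearMap.id (I_mono e h))

variable {e}

/-- The map induced by right multiplication by `e m`. -/
def mu (H : Kos e) {A B : Set (Fin n)} (m : Fin n) (h : B ⊆ insert m A) : Q e B ⟶ Q e A :=
  ModuleCat.ofHom (Submodule.mapQ (I e B) (I e A) (rm e m) (fun _ ha => H.mul_mem h ha))

lemma pr_comp {A B D : Set (Fin n)} (h : A ⊆ B) (h' : B ⊆ D) :
    pr e h ≫ pr e h' = pr e (h.trans h') := by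
  ext
  rfl

lemma pr_self {A : Set (Fin n)} (h : A ⊆ A) : pr e h = 𝟙 _ := by
  ext
  rfl

lemma mu_pr (H : Kos e) {A B : Set (Fin n)} (m : Fin n) (h : B = insert m A) :
    mu H m h.subset ≫ pr e (h ▸ Set.subset_insert m A : A ⊆ B) = 0 := by
  ext
  refine (Submodule.Quotient.mk_eq_zero _).mpr ?_
  exact e_mem e (by rw [h]; exact Set.mem_insert _ _) _

/-- The basic short complex. -/
abbrev sc (H : Kos e) {A B : Set (Fin n)} (m : Fin n) (h : B = insert m A) :
    ShortComplex (ModuleCat.{v} R) := ShortComplex.mk _ _ (mu_pr H m h)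

lemma sc_exact (H : Kos e) {A B : Set (Fin n)} (m : Fin n) (h : B = insert m A) (hm : m ∉ A) :
    (sc H m h).ShortExact := by
  refine ModuleCat.shortComplex_shortExact _ ?_ ?_ ?_
  · intro y
    constructor
    · intro hy
      obtain ⟨y, rfl⟩ := Submodule.Quotient.mk_surjective _ y
      have hy' : y ∈ I e B := (Submodule.Quotient.mk_eq_zero _).mp hy
      rw [h] at hy'
      obtain ⟨c, hc⟩ := mem_I_insert e hy'
      refine ⟨Submodule.Quotient.mk c, ?_⟩
      refine (Submodule.Quotient.eq _).mpr ?_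
      rw [← neg_mem_iff, neg_sub]
      exact hc
    · rintro ⟨x, rfl⟩
      have := congrArg (fun f => f.hom x) (mu_pr H m h)
      exact this
  · refine (injective_iff_map_eq_zero (sc H m h).f.hom).mpr ?_
    intro y hy
    obtain ⟨y, rfl⟩ := Submodule.Quotient.mk_surjective _ y
    refine (Submodule.Quotient.mk_eq_zero _).mpr ?_
    have hy' : y * e m ∈ I e A := (Submodule.Quotient.mk_eq_zero _).mp hy
    rw [h]
    exact H.key A m y hm hy'
  · intro y
    obtain ⟨y, rfl⟩ := Submodule.Quotient.mk_surjective _ y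
    exact ⟨Submodule.Quotient.mk y, rfl⟩


section Comm

variable {A Ba Bb U : Set (Fin n)} (a b : Fin n) (hBa : Ba = insert a A) (hBb : Bb = insert b A)
  (hUa : U = insert a Bb) (hUb : U = insert b Ba) (haA : a ∉ A) (hbA : b ∉ A)
  (haB : a ∉ Bb) (hbB : b ∉ Ba)

variable (e) in
/-- The map `(s, t) ↦ s e_a + t e_b`. -/
def mu2 : R × R →ₗ[R] R := (rm e a).coprod (rm e b)

variable (e) in
/-- Radical of `Q A`. -/
abbrev Rad (A : Set (Fin n)) : ModuleCat.{v} R :=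
  ModuleCat.of R ((R × R) ⧸ (I e A).comap (mu2 e a b))

variable (e) in
/-- The direct sum `Q Ba ⊕ Q Bb`. -/
abbrev Sm (Ba Bb : Set (Fin n)) : ModuleCat.{v} R :=
  ModuleCat.of R ((R × R) ⧸ (I e Ba).prod (I e Bb))

/-- First map of the first sequence. -/
def i1 : Rad e a b A ⟶ Q e A := ModuleCat.ofHom (Submodule.mapQ _ _ (mu2 e a b) le_rfl)

include hBa hBb hUa in
lemma i1_w (hAU : A ⊆ U) : i1 a b ≫ pr e hAU = 0 := by
  refine ModuleCat.hom_ext (Submodule.linearMap_qext _ (LinearMap.ext fun ⟨s, t⟩ => ?_))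
  refine (Submodule.Quotient.mk_eq_zero _).mpr ?_
  refine add_mem (e_mem e ?_ s) (e_mem e ?_ t)
  · rw [hUa]; simp
  · rw [hUa, hBb]; simp

/-- First sequence. -/
lemma s1_exact (hAU : A ⊆ U) :
    (ShortComplex.mk _ _ (i1_w (e := e) a b hBa hBb hUa hAU)).ShortExact := by
  refine ModuleCat.shortComplex_shortExact _ ?_ ?_ ?_
  · intro y
    constructor
    · intro hy
      obtain ⟨y, rfl⟩ := Submodule.Quotient.mk_surjective _ y
      have hy' : y ∈ I e U := (Submodule.Quotient.mk_eq_zero _).mp hy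
      rw [hUa] at hy'
      obtain ⟨s, hs⟩ := mem_I_insert e hy'
      rw [hBb] at hs
      obtain ⟨t, ht⟩ := mem_I_insert e hs
      refine ⟨Submodule.Quotient.mk (s, t), ?_⟩
      refine (Submodule.Quotient.eq _).mpr ?_
      rw [← neg_mem_iff, neg_sub]
      change y - (s * e a + t * e b) ∈ I e A
      rw [← sub_sub]
      exact ht
    · rintro ⟨x, rfl⟩
      have := congrArg (fun f => f.hom x) (i1_w (e := e) a b hBa hBb hUa hAU)
      exact this
  · refine (injective_iff_map_eq_zero (i1 (e := e) (A := A) a b).hom).mpr ?_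
    intro y hy
    obtain ⟨y, rfl⟩ := Submodule.Quotient.mk_surjective _ y
    have hy' : mu2 e a b y ∈ I e A := (Submodule.Quotient.mk_eq_zero (I e A)).mp hy
    exact (Submodule.Quotient.mk_eq_zero ((I e A).comap (mu2 e a b))).mpr hy'
  · intro y
    obtain ⟨y, rfl⟩ := Submodule.Quotient.mk_surjective _ y
    exact ⟨Submodule.Quotient.mk y, rfl⟩


include hBa hBb hUa hUb haB hbB in
lemma s2_aux (H : Kos e) {s t : R} (h : s * e a + t * e b ∈ I e A) :
    s ∈ I e U ∧ t ∈ I e U := by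
  have ha : s * e a ∈ I e Bb := by
    have h1 : s * e a + t * e b ∈ I e Bb := I_mono e (by rw [hBb]; exact Set.subset_insert _ _) h
    have h2 : t * e b ∈ I e Bb := e_mem e (by rw [hBb]; simp) t
    simpa using sub_mem h1 h2
  have hb : t * e b ∈ I e Ba := by
    have h1 : s * e a + t * e b ∈ I e Ba := I_mono e (by rw [hBa]; exact Set.subset_insert _ _) h
    have h2 : s * e a ∈ I e Ba := e_mem e (by rw [hBa]; simp) s
    simpa using sub_mem h1 h2
  constructor
  · rw [hUa]; exact H.key _ _ _ haB ha
  · rw [hUb]; exact H.key _ _ _ hbB hb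

/-- First map of the second sequence. -/
def i2 (H : Kos e) (hUa : U = insert a Bb) (hUb : U = insert b Ba) : Q e U ⟶ Sm e Ba Bb :=
  ModuleCat.ofHom (Submodule.mapQ _ _ ((rm e b).prod (rm e a))
    (fun _ hx => ⟨H.mul_mem hUb.subset hx, H.mul_mem hUa.subset hx⟩))

/-- Second map of the second sequence. -/
def p2 (H : Kos e) (hBa : Ba = insert a A) (hBb : Bb = insert b A) :
    Sm e Ba Bb ⟶ Rad e a b A :=
  ModuleCat.ofHom (Submodule.mapQ _ _ LinearMap.id
    (fun _ hx => add_mem (H.mul_mem hBa.subset hx.1) (H.mul_mem hBb.subset hx.2)))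

lemma i2_w (H : Kos e) : i2 a b H hUa hUb ≫ p2 a b H hBa hBb = 0 := by
  refine ModuleCat.hom_ext (Submodule.linearMap_qext _ (LinearMap.ext fun s => ?_))
  refine (Submodule.Quotient.mk_eq_zero _).mpr ?_
  change (s * e b) * e a + (s * e a) * e b ∈ I e A
  rw [mul_assoc, mul_assoc, H.anti b a, mul_neg, neg_add_cancel]
  exact zero_mem _

include haA hbA haB hbB in
/-- Second sequence. -/
lemma s2_exact (H : Kos e) :
    (ShortComplex.mk _ _ (i2_w a b hBa hBb hUa hUb H)).ShortExact := by
  refine ModuleCat.shortComplex_shortExact _ ?_ ?_ ?_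
  · intro y
    constructor
    · intro hy
      obtain ⟨⟨s, t⟩, rfl⟩ := Submodule.Quotient.mk_surjective _ y
      have hy' : s * e a + t * e b ∈ I e A := by
        have h0 := (Submodule.Quotient.mk_eq_zero ((I e A).comap (mu2 e a b))).mp hy
        exact h0
      have ht := (s2_aux a b hBa hBb hUa hUb haB hbB H hy').2
      rw [hUa] at ht
      obtain ⟨c, hc⟩ := mem_I_insert e ht
      refine ⟨Submodule.Quotient.mk c, ?_⟩
      refine (Submodule.Quotient.eq _).mpr ?_
      rw [← neg_mem_iff, neg_sub]
      refine ⟨?_, hc⟩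
      change s - c * e b ∈ I e Ba
      rw [hBa]
      refine H.key _ _ _ haA ?_
      have h3 := H.mul_mem hBb.subset hc
      have h4 := sub_mem hy' h3
      have h5 : s * e a + t * e b - (t - c * e a) * e b = (s - c * e b) * e a := by
        rw [sub_mul, sub_mul, mul_assoc c, mul_assoc c, H.anti b a, mul_neg]
        abel
      rwa [h5] at h4
    · rintro ⟨x, rfl⟩
      have := congrArg (fun f => f.hom x) (i2_w a b hBa hBb hUa hUb H)
      exact this
  · refine (injective_iff_map_eq_zero (i2 a b H hUa hUb).hom).mpr ?_
    intro y hy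
    obtain ⟨y, rfl⟩ := Submodule.Quotient.mk_surjective _ y
    refine (Submodule.Quotient.mk_eq_zero _).mpr ?_
    have hy' := ((Submodule.Quotient.mk_eq_zero _).mp hy).1
    rw [hUb]
    exact H.key _ _ _ hbB hy'
  · intro y
    obtain ⟨y, rfl⟩ := Submodule.Quotient.mk_surjective _ y
    exact ⟨Submodule.Quotient.mk y, rfl⟩

/-- Coefficient of `e a`. -/
def fa (H : Kos e) (hBa : Ba = insert a A) (hBb : Bb = insert b A)
    (hUa : U = insert a Bb) (hUb : U = insert b Ba) (haB : a ∉ Bb) (hbB : b ∉ Ba) :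
    Rad e a b A ⟶ Q e U :=
  ModuleCat.ofHom (Submodule.mapQ _ _ (LinearMap.fst R R R)
    (fun _ hx => (s2_aux a b hBa hBb hUa hUb haB hbB H hx).1))

/-- Coefficient of `e b`. -/
def fb (H : Kos e) (hBa : Ba = insert a A) (hBb : Bb = insert b A)
    (hUa : U = insert a Bb) (hUb : U = insert b Ba) (haB : a ∉ Bb) (hbB : b ∉ Ba) :
    Rad e a b A ⟶ Q e U :=
  ModuleCat.ofHom (Submodule.mapQ _ _ (LinearMap.snd R R R)
    (fun _ hx => (s2_aux a b hBa hBb hUa hUb haB hbB H hx).2))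

end Comm

variable [HasExt.{w} (ModuleCat.{v} R)]

/-- The basic extension class. -/
def cls (H : Kos e) {A B : Set (Fin n)} (m : Fin n) (h : B = insert m A) (hm : m ∉ A) :
    Ext (Q e B) (Q e B) 1 := (sc_exact H m h hm).extClass

lemma cls_natural (H : Kos e) {A B A' B' : Set (Fin n)} (m : Fin n) (h : B = insert m A) (hm : m ∉ A)
    (h' : B' = insert m A') (hm' : m ∉ A') (hA : A ⊆ A') (hB : B ⊆ B') :
    (cls H m h hm).comp (Ext.mk₀ (pr e hB)) (add_zero 1) =
      (Ext.mk₀ (pr e hB)).comp (cls H m h' hm') (zero_add 1) :=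
  ShortComplex.ShortExact.extClass_naturality (sc_exact H m h hm) (sc_exact H m h' hm')
    { τ₁ := pr e hB
      τ₂ := pr e hA
      τ₃ := pr e hB
      comm₁₂ := by ext; rfl
      comm₂₃ := by ext; rfl }


lemma cls_comm (H : Kos e) {A Ba Bb U : Set (Fin n)} (a b : Fin n)
    (hBa : Ba = insert a A) (hBb : Bb = insert b A)
    (hUa : U = insert a Bb) (hUb : U = insert b Ba) (haA : a ∉ A) (hbA : b ∉ A)
    (haB : a ∉ Bb) (hbB : b ∉ Ba) :
    (cls H a hUa haB).comp (cls H b hUb hbB) (rfl : 1 + 1 = 2) =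
      (cls H b hUb hbB).comp (cls H a hUa haB) (rfl : 1 + 1 = 2) := by
  have hABa : A ⊆ Ba := by rw [hBa]; exact Set.subset_insert _ _
  have hABb : A ⊆ Bb := by rw [hBb]; exact Set.subset_insert _ _
  have hAU : A ⊆ U := hABa.trans (by rw [hUb]; exact Set.subset_insert _ _)
  have S1 := s1_exact (e := e) a b hBa hBb hUa hAU
  have S2 := s2_exact a b hBa hBb hUa hUb haA hbA haB hbB H
  have n1 := ShortComplex.ShortExact.extClass_naturality S1 (sc_exact H a hUa haB)
    { τ₁ := fa a b H hBa hBb hUa hUb haB hbB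
      τ₂ := pr e hABb
      τ₃ := 𝟙 _
      comm₁₂ := by
        refine ModuleCat.hom_ext (Submodule.linearMap_qext _ (LinearMap.ext fun ⟨s, t⟩ => ?_))
        refine (Submodule.Quotient.eq _).mpr ?_
        change s * e a - (s * e a + t * e b) ∈ I e Bb
        rw [sub_add_cancel_left, ← neg_mul]
        exact e_mem e (by rw [hBb]; simp) _
      comm₂₃ := by ext; rfl }
  have n2 := ShortComplex.ShortExact.extClass_naturality S1 (sc_exact H b hUb hbB)
    { τ₁ := fb a b H hBa hBb hUa hUb haB hbB
      τ₂ := pr e hABa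
      τ₃ := 𝟙 _
      comm₁₂ := by
        refine ModuleCat.hom_ext (Submodule.linearMap_qext _ (LinearMap.ext fun ⟨s, t⟩ => ?_))
        refine (Submodule.Quotient.eq _).mpr ?_
        change t * e b - (s * e a + t * e b) ∈ I e Ba
        rw [sub_add_cancel_right, ← neg_mul]
        exact e_mem e (by rw [hBa]; simp) _
      comm₂₃ := by ext; rfl }
  have n3 := ShortComplex.ShortExact.extClass_naturality S2 (sc_exact H b hUb hbB)
    { τ₁ := 𝟙 _
      τ₂ := ModuleCat.ofHom (Submodule.mapQ _ _ (LinearMap.fst R R R) (fun _ hx => hx.1))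
      τ₃ := fa a b H hBa hBb hUa hUb haB hbB
      comm₁₂ := by
        refine ModuleCat.hom_ext (Submodule.linearMap_qext _ (LinearMap.ext fun s => ?_))
        rfl
      comm₂₃ := by
        refine ModuleCat.hom_ext (Submodule.linearMap_qext _ (LinearMap.ext fun s => ?_))
        rfl }
  have n4 := ShortComplex.ShortExact.extClass_naturality S2 (sc_exact H a hUa haB)
    { τ₁ := 𝟙 _
      τ₂ := ModuleCat.ofHom (Submodule.mapQ _ _ (LinearMap.snd R R R) (fun _ hx => hx.2))
      τ₃ := fb a b H hBa hBb hUa hUb haB hbB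
      comm₁₂ := by
        refine ModuleCat.hom_ext (Submodule.linearMap_qext _ (LinearMap.ext fun s => ?_))
        rfl
      comm₂₃ := by
        refine ModuleCat.hom_ext (Submodule.linearMap_qext _ (LinearMap.ext fun s => ?_))
        rfl }
  dsimp only at n1 n2 n3 n4
  rw [Ext.mk₀_id_comp] at n1 n2
  rw [Ext.comp_mk₀_id] at n3 n4
  change _ = cls H a hUa haB at n1
  change _ = cls H b hUb hbB at n2
  change _ = (Ext.mk₀ _).comp (cls H b hUb hbB) _ at n3
  change _ = (Ext.mk₀ _).comp (cls H a hUa haB) _ at n4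
  have q1 : (cls H a hUa haB).comp (cls H b hUb hbB) (rfl : 1 + 1 = 2) =
      S1.extClass.comp S2.extClass rfl := by
    rw [n3, ← Ext.comp_assoc _ _ _ (add_zero 1) _ (by omega), n1]
  have q2 : (cls H b hUb hbB).comp (cls H a hUa haB) (rfl : 1 + 1 = 2) =
      S1.extClass.comp S2.extClass rfl := by
    rw [n4, ← Ext.comp_assoc _ _ _ (add_zero 1) _ (by omega), n2]
  rw [q1, q2]

end Concrete

section Final

/-- The generators of the exterior algebra. -/
def gen (i : Fin (Module.finrank k V)) : ExteriorAlgebra k V :=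
  ExteriorAlgebra.ι k (Module.finBasis k V i)

omit [CharZero k] in
lemma contract_mem (A : Set (Fin (Module.finrank k V))) (m : Fin (Module.finrank k V)) (hm : m ∉ A)
    {x : ExteriorAlgebra k V} (hx : x ∈ I (gen k V) A) :
    ∀ r : ExteriorAlgebra k V,
      CliffordAlgebra.contractRight (Q := (0 : QuadraticForm k V)) (r * x)
        ((Module.finBasis k V).coord m) ∈ I (gen k V) A := by
  induction hx using Submodule.span_induction with
  | mem x hx =>
    obtain ⟨i, hi, rfl⟩ := hx
    intro r
    have h0 : (Module.finBasis k V).coord m (Module.finBasis k V i) = 0 := by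
      rw [Module.Basis.coord_apply, Module.Basis.repr_self, Finsupp.single_apply, if_neg]
      rintro rfl
      exact hm hi
    have := CliffordAlgebra.contractRight_mul_ι (Q := (0 : QuadraticForm k V))
      ((Module.finBasis k V).coord m) (Module.finBasis k V i) r
    rw [h0, zero_smul, zero_sub, ← neg_mul] at this
    have h2 := e_mem (gen k V) hi (-CliffordAlgebra.contractRight (Q := (0 : QuadraticForm k V)) r
      ((Module.finBasis k V).coord m))
    exact this ▸ h2
  | zero => intro r; simp
  | add x y _ _ hx hy =>
    intro r
    rw [mul_add, map_add, LinearMap.add_apply]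
    exact add_mem (hx r) (hy r)
  | smul s x _ hx =>
    intro r
    rw [smul_eq_mul, ← mul_assoc]
    exact hx (r * s)

omit [CharZero k] in
lemma kos : Kos (gen k V) where
  anti i j := eq_neg_of_add_eq_zero_left
    (ExteriorAlgebra.ι_add_mul_swap (Module.finBasis k V i) (Module.finBasis k V j))
  sq i := ExteriorAlgebra.ι_sq_zero _
  key A m a hm ha := by
    have h1 := contract_mem k V A m hm ha 1
    rw [one_mul] at h1
    have h2 := CliffordAlgebra.contractRight_mul_ι (Q := (0 : QuadraticForm k V))
      ((Module.finBasis k V).coord m) (Module.finBasis k V m) a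
    have h0 : (Module.finBasis k V).coord m (Module.finBasis k V m) = 1 := by
      rw [Module.Basis.coord_apply, Module.Basis.repr_self, Finsupp.single_apply, if_pos rfl]
    rw [h0, one_smul] at h2
    have h3 : a - CliffordAlgebra.contractRight (Q := (0 : QuadraticForm k V)) a
        ((Module.finBasis k V).coord m) * gen k V m ∈ I (gen k V) A := h2 ▸ h1
    have h4 := e_mem (gen k V) (Set.mem_insert m A)
      (CliffordAlgebra.contractRight (Q := (0 : QuadraticForm k V)) a
        ((Module.finBasis k V).coord m))
    have h5 := add_mem (I_mono (gen k V) (Set.subset_insert m A) h3) h4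
    rwa [sub_add_cancel] at h5

/-- The augmentation as a map of modules. -/
def aug : ExteriorAlgebra k V →ₗ[ExteriorAlgebra k V] k :=
  LinearMap.toSpanSingleton (ExteriorAlgebra k V) k 1

omit [CharZero k] [FiniteDimensional k V] in
lemma smul_def' (a : ExteriorAlgebra k V) (c : k) :
    a • c = ExteriorAlgebra.algebraMapInv a * c := rfl

omit [CharZero k] [FiniteDimensional k V] in
lemma aug_apply (a : ExteriorAlgebra k V) : aug k V a = ExteriorAlgebra.algebraMapInv a :=
  mul_one _

omit [CharZero k] [FiniteDimensional k V] in
lemma aug_one : aug k V 1 = 1 := by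
  rw [aug_apply, map_one]

omit [CharZero k] in
lemma I_le_ker (A : Set (Fin (Module.finrank k V))) :
    I (gen k V) A ≤ LinearMap.ker (aug k V) := by
  refine Submodule.span_le.mpr ?_
  rintro _ ⟨i, _, rfl⟩
  change aug k V _ = 0
  rw [aug_apply]
  simp [gen, ExteriorAlgebra.algebraMapInv]

omit [CharZero k] in
lemma gen_mem (v : V) : ExteriorAlgebra.ι k v ∈ I (gen k V) Set.univ := by
  rw [← (Module.finBasis k V).sum_repr v, map_sum]
  refine sum_mem fun i _ => ?_
  rw [map_smul, Algebra.smul_def]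
  exact e_mem (gen k V) (Set.mem_univ i) _

omit [CharZero k] in
lemma sub_mem_I (a : ExteriorAlgebra k V) :
    a - algebraMap k (ExteriorAlgebra k V) (ExteriorAlgebra.algebraMapInv a) ∈
      I (gen k V) Set.univ := by
  induction a using ExteriorAlgebra.induction with
  | algebraMap r => 
    rw [ExteriorAlgebra.algebraMap_leftInverse V r, sub_self]
    exact zero_mem _
  | ι v =>
    have : ExteriorAlgebra.algebraMapInv (ExteriorAlgebra.ι k v) = (0 : k) := by
      simp [ExteriorAlgebra.algebraMapInv]
    rw [this, map_zero, sub_zero]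
    exact gen_mem k V v
  | mul a b ha hb =>
    have h1 := (I (gen k V) Set.univ).smul_mem a hb
    have h2 := (I (gen k V) Set.univ).smul_mem
      (algebraMap k (ExteriorAlgebra k V) (ExteriorAlgebra.algebraMapInv b)) ha
    have h3 := add_mem h1 h2
    rw [smul_eq_mul, smul_eq_mul, Algebra.commutes, mul_sub, sub_mul, sub_add_sub_cancel] at h3
    rwa [map_mul, map_mul]
  | add a b ha hb =>
    rw [map_add, map_add, add_sub_add_comm]
    exact add_mem ha hb

lemma pr_lift {R : Type*} [Ring R] {M : Type _} [AddCommGroup M] [Module R M] {n : ℕ}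
    {e : Fin n → R} (f : R →ₗ[R] M) {A B : Set (Fin n)} (h : A ⊆ B)
    (hA : I e A ≤ LinearMap.ker f) (hB : I e B ≤ LinearMap.ker f) :
    pr e h ≫ ModuleCat.ofHom ((I e B).liftQ f hB) = ModuleCat.ofHom ((I e A).liftQ f hA) := by
  refine ModuleCat.hom_ext (Submodule.linearMap_qext _ (LinearMap.ext fun s => ?_))
  rfl

/-- The augmentation of `Q A`. -/
def pa (A : Set (Fin (Module.finrank k V))) :
    Q (gen k V) A ⟶ ModuleCat.of (ExteriorAlgebra k V) k :=
  ModuleCat.ofHom ((I (gen k V) A).liftQ (aug k V) (I_le_ker k V A))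

omit [CharZero k] in
lemma pr_pa {A B : Set (Fin (Module.finrank k V))} (h : A ⊆ B) :
    pr (gen k V) h ≫ pa k V B = pa k V A := by
  exact pr_lift (aug k V) h _ _

omit [CharZero k] in
lemma pa_iso (A : Set (Fin (Module.finrank k V))) (h : A = Set.univ) : IsIso (pa k V A) := by
  subst h
  rw [ConcreteCategory.isIso_iff_bijective]
  constructor
  · refine (injective_iff_map_eq_zero (pa k V Set.univ).hom).mpr ?_
    intro y hy
    obtain ⟨y, rfl⟩ := Submodule.Quotient.mk_surjective _ y
    have hy' : aug k V y = 0 := hy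
    have := sub_mem_I k V y
    rw [aug_apply] at hy'
    rw [hy', map_zero, sub_zero] at this
    exact (Submodule.Quotient.mk_eq_zero _).mpr this
  · intro c
    refine ⟨Submodule.Quotient.mk (algebraMap k _ c), ?_⟩
    change aug k V _ = c
    rw [aug_apply]
    exact ExteriorAlgebra.algebraMap_leftInverse V c

/-- The inverse of the augmentation. -/
def pinv : ModuleCat.of (ExteriorAlgebra k V) k ⟶ Q (gen k V) Set.univ :=
  haveI := pa_iso k V Set.univ rfl
  inv (pa k V Set.univ)

omit [CharZero k] in
lemma pa_pinv : pa k V Set.univ ≫ pinv k V = 𝟙 _ := by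
  haveI := pa_iso k V Set.univ rfl
  exact IsIso.hom_inv_id _

omit [CharZero k] in
lemma pinv_pa : pinv k V ≫ pa k V Set.univ = 𝟙 _ := by
  haveI := pa_iso k V Set.univ rfl
  exact IsIso.inv_hom_id _

lemma univ_eq {n : ℕ} (m : Fin n) : (Set.univ : Set (Fin n)) = insert m ({m}ᶜ) := by
  ext i; simp [em]

lemma not_mem {n : ℕ} (m : Fin n) : m ∉ ({m}ᶜ : Set (Fin n)) := by simp

/-- The generating classes. -/
def xx (m : Fin (Module.finrank k V)) :
    Ext (ModuleCat.of (ExteriorAlgebra k V) k) (ModuleCat.of (ExteriorAlgebra k V) k) 1 :=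
  (Ext.mk₀ (pinv k V)).comp
    ((cls (kos k V) m (univ_eq m) (not_mem m)).comp (Ext.mk₀ (pa k V Set.univ)) (add_zero 1))
    (zero_add 1)

lemma pa_xx (m : Fin (Module.finrank k V)) :
    (Ext.mk₀ (pa k V Set.univ)).comp (xx k V m) (zero_add 1) =
      (cls (kos k V) m (univ_eq m) (not_mem m)).comp (Ext.mk₀ (pa k V Set.univ)) (add_zero 1) := by
  rw [xx, Ext.mk₀_comp_mk₀_assoc, pa_pinv, Ext.mk₀_id_comp]

lemma xx_xx (a b : Fin (Module.finrank k V)) :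
    (xx k V a).comp (xx k V b) (rfl : 1 + 1 = 2) =
    (Ext.mk₀ (pinv k V)).comp
    (((cls (kos k V) a (univ_eq a) (not_mem a)).comp
      (cls (kos k V) b (univ_eq b) (not_mem b)) (rfl : 1 + 1 = 2)).comp
        (Ext.mk₀ (pa k V Set.univ)) (add_zero 2))
    (zero_add 2) := by
  have h := pa_xx k V b
  rw [xx, Ext.comp_assoc _ _ _ (zero_add 1) (rfl : 1 + 1 = 2) (by omega),
    Ext.comp_assoc _ _ _ (add_zero 1) (zero_add 1) (by omega), h,
    Ext.comp_assoc _ _ _ (rfl : 1 + 1 = 2) (add_zero 1) (by omega)]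

lemma xx_comm (a b : Fin (Module.finrank k V)) :
    (xx k V a).comp (xx k V b) (rfl : 1 + 1 = 2) =
      (xx k V b).comp (xx k V a) (rfl : 1 + 1 = 2) := by
  by_cases hab : a = b
  · rw [hab]
  · rw [xx_xx, xx_xx, cls_comm (kos k V) (A := {a, b}ᶜ) a b]
    · ext i
      by_cases h1 : i = a
      · subst h1; simp [hab]
      · simp [h1]
    · ext i
      by_cases h1 : i = b
      · subst h1; simp [Ne.symm hab]
      · simp [h1]
    · simp
    · simp

/-- The sets of the tower. -/
def lt (n j : ℕ) : Set (Fin n) := {i | i.val < j}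

lemma lt_succ {n j : ℕ} (hj : j < n) : lt n (j + 1) = insert ⟨j, hj⟩ (lt n j) := by
  ext i
  simp only [lt, Set.mem_ofPred_eq, Set.mem_insert_iff, Fin.ext_iff]
  omega

lemma not_lt {n j : ℕ} (hj : j < n) : (⟨j, hj⟩ : Fin n) ∉ lt n j := by
  simp [lt]

lemma lt_sub {n j : ℕ} (hj : j < n) : lt n j ⊆ ({⟨j, hj⟩}ᶜ : Set (Fin n)) := by
  intro i hi
  simp only [lt, Set.mem_ofPred_eq] at hi
  simp only [Set.mem_compl_iff, Set.mem_singleton_iff, Fin.ext_iff]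
  omega

/-- The tower of cyclic modules. -/
def tower : Tower (xx k V) where
  N j := Q (gen k V) (lt _ j)
  ι j hj := mu (kos k V) ⟨j, hj⟩ (lt_succ hj).subset
  p j hj := pr (gen k V) (lt_succ hj ▸ Set.subset_insert _ _ : lt _ j ⊆ lt _ (j + 1))
  w j hj := mu_pr (kos k V) ⟨j, hj⟩ (lt_succ hj)
  ex j hj := sc_exact (kos k V) ⟨j, hj⟩ (lt_succ hj) (not_lt hj)
  π j := pa k V (lt _ j)
  hp j hj := pr_pa k V _
  hx j hj := by
    have h1 := cls_natural (kos k V) ⟨j, hj⟩ (lt_succ hj) (not_lt hj) (univ_eq _) (not_mem _)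
      (lt_sub hj) (Set.subset_univ _)
    have h2 := pr_pa k V (Set.subset_univ (lt (Module.finrank k V) (j + 1)))
    rw [← h2, ← Ext.mk₀_comp_mk₀, Ext.comp_assoc _ _ _ (zero_add 0) (zero_add 1) (by omega), pa_xx,
      ← Ext.comp_assoc _ _ _ (add_zero 1) (zero_add 0) (by omega),
      ← Ext.comp_assoc _ _ _ (zero_add 1) (add_zero 1) (by omega), ← h1]
    rfl

omit [CharZero k] in
lemma smul_hom (A : Set (Fin (Module.finrank k V))) (c : k) (y : Q (gen k V) A) :
    (c • pa k V A).hom y = c * (pa k V A).hom y := by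
  change (algebraMap k (ExteriorAlgebra k V) c) • (show k from (pa k V A).hom y) = _
  rw [smul_def', ExteriorAlgebra.algebraMap_leftInverse V c]

omit [CharZero k] in
lemma I_zero : I (gen k V) (lt _ 0) = ⊥ := by
  have : lt (Module.finrank k V) 0 = ∅ := by ext i; simp [lt]
  rw [I, this, Set.image_empty, Submodule.span_empty]

lemma proj_zero : Projective ((tower k V).N 0) := by
  change Projective (Q (gen k V) (lt _ 0))
  have e := (Submodule.quotEquivOfEqBot _ (I_zero k V))
  haveI : Module.Projective (ExteriorAlgebra k V) (ExteriorAlgebra k V ⧸ I (gen k V) (lt _ 0)) :=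
    Module.Projective.of_equiv e.symm
  exact (IsProjective.iff_projective _).mp this

lemma tower_h0 (f : (tower k V).N 0 ⟶ ModuleCat.of (ExteriorAlgebra k V) k) :
    ∃ c : k, f = c • (tower k V).π 0 := by
  change Q (gen k V) (lt _ 0) ⟶ _ at f
  refine ⟨f.hom (Submodule.Quotient.mk 1), ?_⟩
  change f = _ • pa k V (lt _ 0)
  refine ModuleCat.hom_ext (Submodule.linearMap_qext _ (LinearMap.ext_ring ?_))
  change f.hom (Submodule.Quotient.mk 1) = ((f.hom (Submodule.Quotient.mk 1) : k) •
    pa k V (lt _ 0)).hom (Submodule.Quotient.mk 1)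
  rw [smul_hom]
  change _ = _ * aug k V 1
  rw [aug_one, mul_one]

lemma tower_h1 (c : k) (h : c • (tower k V).π 0 = 0) : c = 0 := by
  change c • pa k V (lt _ 0) = 0 at h
  have h1 := smul_hom k V (lt _ 0) c (Submodule.Quotient.mk 1)
  rw [h] at h1
  change 0 = c * aug k V 1 at h1
  rw [aug_one, mul_one] at h1
  exact h1.symm

lemma tower_iso : IsIso ((tower k V).π (Module.finrank k V)) :=
  pa_iso k V _ (by ext i; simp [lt])

end Final

end KoszulAux

/-- Koszul duality for the exterior algebra.  Let `Λ = ⋀V` be the exterior algebra of a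
finite-dimensional `k`-vector space `V` (char `k = 0`) and `k_∧` the trivial `Λ`-module.
The symmetric algebra `Sym(V*)` is realized, via a choice of basis of `V`, as the
polynomial algebra in `n = dim V` variables, with `Sym^i(V*)` its homogeneous degree-`i`
part.  Then there is a family of `k`-linear isomorphisms
`φ_i : Sym^i(V*) → Ext^i_Λ(k_∧, k_∧)` with `φ_0(1) = id` and
`φ_{i+j}(p·q) = φ_i(p) ∘ φ_j(q)` (Yoneda composition); i.e. the Yoneda Ext-algebra of
`k_∧` is the symmetric algebra `Sym(V*)` with `Sym^i` in degree `i`. -/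
theorem koszul_duality_exterior_algebra :
    ∃ φ : ∀ i : ℕ,
        (MvPolynomial.homogeneousSubmodule (Fin (Module.finrank k V)) k i) →+
          Abelian.Ext (ModuleCat.of (ExteriorAlgebra k V) k)
            (ModuleCat.of (ExteriorAlgebra k V) k) i,
      (∀ i, Function.Bijective (φ i)) ∧
      (∀ (i : ℕ) (c : k) (p : MvPolynomial.homogeneousSubmodule (Fin (Module.finrank k V)) k i),
        φ i (c • p) =
          (Abelian.Ext.mk₀ (c • 𝟙 (ModuleCat.of (ExteriorAlgebra k V) k))).comp
            (φ i p) (Nat.zero_add i)) ∧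
      (φ 0 ⟨1, (MvPolynomial.mem_homogeneousSubmodule _ _).mpr
          (MvPolynomial.isHomogeneous_one _ _)⟩ =
        Abelian.Ext.mk₀ (𝟙 (ModuleCat.of (ExteriorAlgebra k V) k))) ∧
      (∀ (i j : ℕ) (p : MvPolynomial.homogeneousSubmodule (Fin (Module.finrank k V)) k i)
          (q : MvPolynomial.homogeneousSubmodule (Fin (Module.finrank k V)) k j),
        φ (i + j) ⟨(p : MvPolynomial (Fin (Module.finrank k V)) k) * q,
            (MvPolynomial.mem_homogeneousSubmodule _ _).mpr
              (MvPolynomial.IsHomogeneous.mul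
                ((MvPolynomial.mem_homogeneousSubmodule _ _).mp p.2)
                ((MvPolynomial.mem_homogeneousSubmodule _ _).mp q.2))⟩ =
          (φ i p).comp (φ j q) rfl) := by

  obtain ⟨P, hP⟩ := KoszulAux.exists_algHom (F := k)
    (fun a => KoszulAux.op (F := k) (KoszulAux.xx k V a))
    (fun a b => KoszulAux.op_comm _ _ (KoszulAux.xx_comm k V a b))
  haveI := KoszulAux.proj_zero k V
  haveI := KoszulAux.tower_iso k V
  have hb := KoszulAux.Tower.bij P hP (KoszulAux.tower k V) (KoszulAux.tower_h0 k V)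
    (KoszulAux.tower_h1 k V)
  refine ⟨fun i => ((KoszulAux.phi P i).comp (Submodule.subtype _)).toAddMonoidHom,
    fun i => ⟨?_, ?_⟩, ?_, ?_, ?_⟩
  · refine (injective_iff_map_eq_zero _).mpr ?_
    rintro ⟨f, hf⟩ h
    exact Subtype.ext ((hb i).2 f hf h)
  · intro y
    obtain ⟨f, hf, h⟩ := (hb i).1 y
    exact ⟨⟨f, hf⟩, h⟩
  · intro i c p
    change KoszulAux.phi P i (c • (p : MvPolynomial (Fin (Module.finrank k V)) k)) =
      (Abelian.Ext.mk₀ (c • 𝟙 (ModuleCat.of (ExteriorAlgebra k V) k))).comp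
        (KoszulAux.phi P i (p : MvPolynomial (Fin (Module.finrank k V)) k)) (Nat.zero_add i)
    rw [map_smul]
    have h1 : Abelian.Ext.mk₀ (c • 𝟙 (ModuleCat.of (ExteriorAlgebra k V) k)) =
      c • Abelian.Ext.mk₀ (𝟙 (ModuleCat.of (ExteriorAlgebra k V) k)) := Abelian.Ext.mk₀_smul _ _
    rw [h1, Abelian.Ext.smul_comp, Abelian.Ext.mk₀_id_comp]
  · exact KoszulAux.phi_one P
  · intro i j p q
    exact KoszulAux.phi_mul _ P hP i j p q p.2
end
end
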